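/- arXiv:1411.0697 — 2 statements merged into one kernel-verified Lean document; each statement's English description precedes it below -/
import Mathlib

section
/- Let 1<p₁,p₂<∞, 0<α<2n, α/n < 1/p₁ + 1/p₂ < 2, 1/q = 1/p₁ + 1/p₂ − α/n with 1<q<∞, let ε>0, and let γ₂ > γ₁ > 2 and γ₃ > 0 be the constants from the annulus estimates. Then there exists β with 0 < β < γ₂, depending only on p₁, p₂, n, α, q, and ε, such that for every real-valued b with ‖b‖_{BMO} = 1, every cube Q_j with center y_j and side length d_j satisfying ⨍_{Q_j}|b − b_{Q_j}| ≥ ε, and every measurable set E ⊂ {x : γ₁ d_j < |x−y_j| < γ₂ d_j} with |E|/|Q_j| < βⁿ, one has (∫_E |[b,I_α]₁(f_j,g_j)(x)|^q dx)^{1/q} ≤ γ₃/4, where f_j, g_j are the associated test functions. -/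
open MeasureTheory Set Filter
open scoped ENNReal BigOperators Topology

noncomputable section

/-- Euclidean space `ℝⁿ`. -/
abbrev Rn (n : ℕ) : Type := EuclideanSpace ℝ (Fin n)

/-- The closed axis-parallel cube with center `c` and side length `d`. -/
def cube (n : ℕ) (c : Rn n) (d : ℝ) : Set (Rn n) :=
  {x | ∀ i : Fin n, |x i - c i| ≤ d / 2}

/-- The average `b_Q` of `b` over the cube with center `c` and side length `d`. -/
def cubeAvg (n : ℕ) (b : Rn n → ℝ) (c : Rn n) (d : ℝ) : ℝ :=
  ⨍ x in cube n c d, b x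

/-- The mean oscillation `⨍_Q |b - b_Q|` of `b` over a cube. -/
def osc (n : ℕ) (b : Rn n → ℝ) (c : Rn n) (d : ℝ) : ℝ :=
  ⨍ x in cube n c d, |b x - cubeAvg n b c d|

/-- The BMO seminorm: supremum of mean oscillations over all axis-parallel cubes. -/
def bmoNorm (n : ℕ) (b : Rn n → ℝ) : ℝ :=
  ⨆ cd : Rn n × {d : ℝ // 0 < d}, osc n b cd.1 cd.2.1

/-- `b ∈ CMO`: `b` belongs to the closure of `C_c^∞` in the BMO seminorm. -/
def MemCMO (n : ℕ) (b : Rn n → ℝ) : Prop :=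
  ∀ ε : ℝ, 0 < ε → ∃ φ : Rn n → ℝ, ContDiff ℝ (⊤ : ℕ∞) φ ∧ HasCompactSupport φ ∧
    bmoNorm n (b - φ) < ε

/-- The conjugate exponent `p' = p/(p-1)`. -/
def conjExp (p : ℝ) : ℝ := p / (p - 1)

/-- The Muckenhoupt class `A_p`. -/
def MuckenhouptAp (n : ℕ) (p : ℝ) (w : Rn n → ℝ) : Prop :=
  (∀ x, 0 ≤ w x) ∧ LocallyIntegrable w volume ∧
  ∃ C : ℝ, ∀ (c : Rn n) (d : ℝ), 0 < d →
    (⨍ x in cube n c d, w x) *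
      (⨍ x in cube n c d, w x ^ (1 - conjExp p)) ^ (p / conjExp p) ≤ C

/-- The `A_p` characteristic constant `[w]_{A_p}`. -/
def apConst (n : ℕ) (p : ℝ) (w : Rn n → ℝ) : ℝ :=
  ⨆ cd : Rn n × {d : ℝ // 0 < d},
    (⨍ x in cube n cd.1 cd.2.1, w x) *
      (⨍ x in cube n cd.1 cd.2.1, w x ^ (1 - conjExp p)) ^ (p / conjExp p)

/-- The bilinear class `A_{P,q}` for `P = (p₁,p₂)`. -/
def MuckenhouptAPq (n : ℕ) (p₁ p₂ q : ℝ) (w₁ w₂ : Rn n → ℝ) : Prop :=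
  ∃ C : ℝ, ∀ (c : Rn n) (d : ℝ), 0 < d →
    (⨍ x in cube n c d, (w₁ x * w₂ x) ^ q) *
      (⨍ x in cube n c d, w₁ x ^ (-(conjExp p₁))) ^ (q / conjExp p₁) *
      (⨍ x in cube n c d, w₂ x ^ (-(conjExp p₂))) ^ (q / conjExp p₂) ≤ C

/-- The kernel of the bilinear fractional integral `I_α`. -/
def fracKernel (n : ℕ) (α : ℝ) (x y z : Rn n) : ℝ :=
  (‖x - y‖ ^ 2 + ‖x - z‖ ^ 2) ^ (-((n : ℝ) - α / 2))

/-- The bilinear fractional integral operator `I_α`. -/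
def Iop (n : ℕ) (α : ℝ) (f g : Rn n → ℝ) (x : Rn n) : ℝ :=
  ∫ y, ∫ z, fracKernel n α x y z * (f y * g z)

/-- The first commutator `[b, I_α]₁(f,g) = I_α(bf, g) - b · I_α(f,g)`. -/
def commI (n : ℕ) (α : ℝ) (b f g : Rn n → ℝ) : Rn n → ℝ :=
  fun x => Iop n α (fun y => b y * f y) g x - b x * Iop n α f g x

/-- The weighted Lᵖ norm `(∫ |f|^p w)^{1/p}` (with value in `ℝ≥0∞`). -/
def wNorm (n : ℕ) (p : ℝ) (w : Rn n → ℝ) (f : Rn n → ℝ) : ℝ≥0∞ :=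
  (∫⁻ x, ENNReal.ofReal (|f x| ^ p * w x)) ^ (1 / p)

/-- A bilinear operator `T` is compact from `L^{p₁}(w₁) × L^{p₂}(w₂)` to `L^q(μ)` when the
image of the product of unit balls is precompact in `L^q(μ)`; equivalently (by completeness),
every sequence in the image of the unit balls admits a subsequence which is Cauchy for the
`L^q(μ)` norm. -/
def BilinCompact (n : ℕ) (p₁ p₂ q : ℝ) (w₁ w₂ μ : Rn n → ℝ)
    (T : (Rn n → ℝ) → (Rn n → ℝ) → Rn n → ℝ) : Prop :=
  ∀ F G : ℕ → Rn n → ℝ,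
    (∀ j, wNorm n p₁ w₁ (F j) ≤ 1) → (∀ j, wNorm n p₂ w₂ (G j) ≤ 1) →
    ∃ φ : ℕ → ℕ, StrictMono φ ∧
      ∀ ε : ℝ, 0 < ε → ∃ N : ℕ, ∀ j ≥ N, ∀ k ≥ N,
        wNorm n q μ (fun x => T (F (φ j)) (G (φ j)) x - T (F (φ k)) (G (φ k)) x)
          < ENNReal.ofReal ε

/-- The smoothly truncated kernel `K^δ` with implicit constant `A`. -/
def IsTruncKernel (n : ℕ) (α δ A : ℝ) (K : Rn n → Rn n → Rn n → ℝ) : Prop :=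
  ContDiff ℝ 1 (fun pt : Rn n × Rn n × Rn n => K pt.1 pt.2.1 pt.2.2) ∧
  (∀ x y z, 2 * δ < max ‖x - y‖ ‖x - z‖ → K x y z = fracKernel n α x y z) ∧
  (∀ x y z, max ‖x - y‖ ‖x - z‖ < δ → K x y z = 0) ∧
  (∀ x y z : Rn n, |K x y z| ≤ A * (‖x - y‖ + ‖x - z‖) ^ (-(2 * (n : ℝ) - α))) ∧
  (∀ x y z : Rn n,
    ‖fderiv ℝ (fun pt : Rn n × Rn n × Rn n => K pt.1 pt.2.1 pt.2.2) (x, y, z)‖ ≤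
      A * (‖x - y‖ + ‖x - z‖) ^ (-(2 * (n : ℝ) - α - 1)))

/-- The bilinear operator with kernel `K`. -/
def IopK (n : ℕ) (K : Rn n → Rn n → Rn n → ℝ) (f g : Rn n → ℝ) (x : Rn n) : ℝ :=
  ∫ y, ∫ z, K x y z * (f y * g z)

/-- The first commutator of the truncated operator. -/
def commIK (n : ℕ) (K : Rn n → Rn n → Rn n → ℝ) (b f g : Rn n → ℝ) : Rn n → ℝ :=
  fun x => IopK n K (fun y => b y * f y) g x - b x * IopK n K f g x

/-- The bilinear fractional maximal function `M_α`. -/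
def Mmax (n : ℕ) (α : ℝ) (f g : Rn n → ℝ) (x : Rn n) : ℝ :=
  ⨆ cd : {cd : Rn n × ℝ // 0 < cd.2 ∧ x ∈ cube n cd.1 cd.2},
    ((cd : Rn n × ℝ).2 ^ n) ^ (α / n) *
      ((⨍ y in cube n (cd : Rn n × ℝ).1 (cd : Rn n × ℝ).2, |f y|) *
        (⨍ z in cube n (cd : Rn n × ℝ).1 (cd : Rn n × ℝ).2, |g z|))

/-- The test function `f_j` associated to the cube with center `c`, side `d` and symbol `b`:
`f_j = |Q|^{-1/p₁} (sgn(b - b_Q) - c₀) χ_Q` where `c₀ = ⨍_Q sgn(b - b_Q)`. -/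
def testF (n : ℕ) (p₁ : ℝ) (b : Rn n → ℝ) (c : Rn n) (d : ℝ) : Rn n → ℝ :=
  indicator (cube n c d) fun y =>
    (d ^ n) ^ (-(1 / p₁)) *
      (Real.sign (b y - cubeAvg n b c d) -
        ⨍ z in cube n c d, Real.sign (b z - cubeAvg n b c d))

/-- The test function `g_j = |Q|^{-1/p₂} χ_Q` associated to the cube with center `c`, side `d`. -/
def testG (n : ℕ) (p₂ : ℝ) (c : Rn n) (d : ℝ) : Rn n → ℝ :=
  indicator (cube n c d) fun _ => (d ^ n) ^ (-(1 / p₂))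

end


namespace JN
variable {n : ℕ}

noncomputable def V (n : ℕ) (r : ℝ) : ℝ≥0∞ := ENNReal.ofReal ((2 * r) ^ n)

lemma vol_ball (c : Fin n → ℝ) {r : ℝ} (hr : 0 ≤ r) :
    volume (Metric.closedBall c r) = V n r := by
  rw [Real.volume_pi_closedBall _ hr]; simp [V]

lemma V_pos {r : ℝ} (hr : 0 < r) : 0 < V n r := by
  unfold V; rw [ENNReal.ofReal_pos]; positivity

lemma V_ne_top {r : ℝ} : V n r ≠ ⊤ := ENNReal.ofReal_ne_top

lemma V_mul {s r : ℝ} (hs : 0 ≤ s) : V n (s * r) = ENNReal.ofReal (s ^ n) * V n r := by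
  unfold V; rw [← ENNReal.ofReal_mul (by positivity)]; congr 1; rw [← mul_pow]; congr 1; ring

noncomputable def m (b : (Fin n → ℝ) → ℝ) (c : Fin n → ℝ) (r : ℝ) : ℝ :=
  ⨍ x in Metric.closedBall c r, b x

variable {b : (Fin n → ℝ) → ℝ}

lemma intOn (hb : LocallyIntegrable b volume) (c : Fin n → ℝ) (r : ℝ) :
    IntegrableOn b (Metric.closedBall c r) volume :=
  hb.integrableOn_isCompact (isCompact_closedBall c r)

lemma m_sub (hb : LocallyIntegrable b volume) (c : Fin n → ℝ) {r : ℝ} (hr : 0 < r) (a : ℝ) :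
    ‖m b c r - a‖ₑ * V n r ≤ ∫⁻ x in Metric.closedBall c r, ‖b x - a‖ₑ := by
  have hi := intOn hb c r
  have hv : volume (Metric.closedBall c r) ≠ ⊤ := by rw [vol_ball c hr.le]; exact V_ne_top
  have hvr : volume.real (Metric.closedBall c r) ≠ 0 := by
    rw [measureReal_def, vol_ball c hr.le]
    exact (ENNReal.toReal_pos (V_pos hr).ne' V_ne_top).ne'
  have h1 : ∫ x in Metric.closedBall c r, (b x - a)
      = (m b c r - a) * volume.real (Metric.closedBall c r) := by
    have : IsFiniteMeasure (volume.restrict (Metric.closedBall c r)) := ⟨by simpa using hv.lt_top⟩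
    rw [integral_sub hi (integrable_const a)]
    simp only [m, setAverage_eq, integral_const, smul_eq_mul, MeasurableSet.univ, measureReal_restrict_apply, univ_inter]
    field_simp
  have h2 := enorm_integral_le_lintegral_enorm (μ := volume.restrict (Metric.closedBall c r)) (fun x => b x - a)
  rw [h1, enorm_mul] at h2
  convert h2 using 2
  rw [Real.enorm_of_nonneg measureReal_nonneg, measureReal_def, ENNReal.ofReal_toReal hv, vol_ball c hr.le]

/-- BMO with norm at most one, over sup-norm balls -/
def Bmo (b : (Fin n → ℝ) → ℝ) : Prop := ∀ c r, 0 < r →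
  ∫⁻ x in Metric.closedBall c r, ‖b x - m b c r‖ₑ ≤ V n r

lemma m_diff (hb : LocallyIntegrable b volume) (hB : Bmo b) (c c' : Fin n → ℝ) {r s : ℝ} (hr : 0 < r)
    (hs : 0 < s) (hsub : Metric.closedBall c r ⊆ Metric.closedBall c' (s * r)) :
    ‖m b c r - m b c' (s * r)‖ₑ ≤ ENNReal.ofReal (s ^ n) := by
  have h := (m_sub hb c hr (m b c' (s * r))).trans
    ((lintegral_mono_set hsub).trans (hB c' (s * r) (by positivity)))
  rw [V_mul hs.le] at h
  exact (ENNReal.mul_le_mul_iff_left (V_pos hr).ne' V_ne_top).1 h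

lemma double (hb : LocallyIntegrable b volume) (hB : Bmo b) (c : Fin n → ℝ) {r : ℝ} (hr : 0 < r) :
    ∫⁻ x in Metric.closedBall c (2 * r), ‖b x - m b c r‖ₑ ≤ ENNReal.ofReal (2 ^ n * (1 + 2 ^ n)) * V n r := by
  have h2 : 0 < 2 * r := by positivity
  calc ∫⁻ x in Metric.closedBall c (2 * r), ‖b x - m b c r‖ₑ
      ≤ ∫⁻ x in Metric.closedBall c (2 * r), (‖b x - m b c (2 * r)‖ₑ + ENNReal.ofReal (2 ^ n)) := by
        apply lintegral_mono
        intro x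
        have : b x - m b c r = (b x - m b c (2 * r)) - (m b c r - m b c (2 * r)) := by ring
        simp only
        rw [this]
        refine (enorm_sub_le).trans ?_
        gcongr
        exact m_diff hb hB c c hr (by norm_num) (Metric.closedBall_subset_closedBall (by linarith))
    _ ≤ V n (2 * r) + ENNReal.ofReal (2 ^ n) * V n (2 * r) := by
        rw [lintegral_add_right _ measurable_const]
        simp only [lintegral_const, MeasurableSet.univ, Measure.restrict_apply, univ_inter]
        rw [vol_ball c h2.le]
        gcongr
        exact hB c _ h2
    _ = _ := by
        rw [V_mul (by norm_num), ENNReal.ofReal_mul (by positivity), ENNReal.ofReal_add (by positivity) (by positivity)]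
        simp only [ENNReal.ofReal_one]
        ring

noncomputable def K (n : ℕ) : ℝ := 2 * 3 ^ n * (2 ^ n * (1 + 2 ^ n))
noncomputable def A (n : ℕ) : ℝ := K n + (3/2) ^ n

lemma K_pos : 0 < K n := by unfold K; positivity

lemma radius (hb : LocallyIntegrable b volume) (hB : Bmo b) (c : Fin n → ℝ) {R : ℝ} (hR : 0 < R)
    (x : Fin n → ℝ) (hx : x ∈ Metric.closedBall c R)
    (hL : Tendsto (fun r => ⨍ y in Metric.closedBall x r, ‖b y - m b c R‖) (𝓝[>] 0) (𝓝 ‖b x - m b c R‖))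
    (hbig : K n < ‖b x - m b c R‖) :
    ∃ r, 0 < r ∧ r ≤ R ∧ Metric.closedBall x r ⊆ Metric.closedBall c (2 * R) ∧
      ENNReal.ofReal (K n) * V n r ≤ ∫⁻ y in Metric.closedBall x r, ‖b y - m b c R‖ₑ ∧
      ∫⁻ y in Metric.closedBall x (2 * r), ‖b y - m b c R‖ₑ ≤ ENNReal.ofReal (K n) * V n (2 * r) := by
  classical
  set a := m b c R
  have hpos : ∀ k : ℕ, 0 < R * (1/2) ^ k := fun k => by positivity
  have hsub : Metric.closedBall x R ⊆ Metric.closedBall c (2 * R) := by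
    apply Metric.closedBall_subset_closedBall'
    rw [Metric.mem_closedBall] at hx; linarith
  have hseq : Tendsto (fun k : ℕ => R * (1/2 : ℝ) ^ k) atTop (𝓝[>] 0) := by
    rw [tendsto_nhdsWithin_iff]
    refine ⟨?_, Eventually.of_forall fun k => hpos k⟩
    simpa using (tendsto_pow_atTop_nhds_zero_of_lt_one (r := (1/2:ℝ)) (by norm_num) (by norm_num)).const_mul R
  have hconv : ∀ r, 0 < r → ENNReal.ofReal (⨍ y in Metric.closedBall x r, ‖b y - a‖) * V n r
      = ∫⁻ y in Metric.closedBall x r, ‖b y - a‖ₑ := by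
    intro r hr
    have hv : volume (Metric.closedBall x r) ≠ ⊤ := by rw [vol_ball x hr.le]; exact V_ne_top
    have : IsFiniteMeasure (volume.restrict (Metric.closedBall x r)) := ⟨by simpa using hv.lt_top⟩
    have hvr : 0 < volume.real (Metric.closedBall x r) := by
      rw [measureReal_def, vol_ball x hr.le]
      exact (ENNReal.toReal_pos (V_pos hr).ne' V_ne_top)
    have hi : Integrable (fun y => b y - a) (volume.restrict (Metric.closedBall x r)) :=
      (intOn hb x r).sub (integrable_const a)
    rw [← ofReal_integral_norm_eq_lintegral_enorm hi,
      setAverage_eq, ← vol_ball x hr.le, ← ENNReal.ofReal_toReal hv, ← measureReal_def,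
      ← ENNReal.ofReal_mul (by rw [smul_eq_mul]; exact mul_nonneg (by positivity) (integral_nonneg fun _ => norm_nonneg _))]
    congr 1
    rw [smul_eq_mul]; field_simp
  have hex : ∃ k : ℕ, ENNReal.ofReal (K n) * V n (R * (1/2) ^ k) < ∫⁻ y in Metric.closedBall x (R * (1/2) ^ k), ‖b y - a‖ₑ := by
    obtain ⟨k, hk⟩ := ((hL.comp hseq).eventually (lt_mem_nhds hbig)).exists
    refine ⟨k, ?_⟩
    rw [← hconv _ (hpos k)]
    rw [ENNReal.mul_lt_mul_iff_left (V_pos (hpos k)).ne' V_ne_top]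
    exact (ENNReal.ofReal_lt_ofReal_iff (K_pos.trans hk)).2 hk
  have hspec := Nat.find_spec hex
  have hmin := fun j => Nat.find_min hex (m := j)
  set k := Nat.find hex
  have hk0 : k ≠ 0 := by
    intro h0
    rw [h0] at hspec
    simp only [pow_zero, mul_one] at hspec
    refine absurd (((lintegral_mono_set hsub).trans (double hb hB c hR))) (not_le.2 (lt_of_le_of_lt ?_ hspec))
    gcongr
    unfold K
    have : (1:ℝ) ≤ 3 ^ n := one_le_pow₀ (by norm_num)
    have h' : (0:ℝ) ≤ (2 ^ n * (1 + 2 ^ n)) := by positivity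
    nlinarith
  obtain ⟨j, hj⟩ := Nat.exists_eq_succ_of_ne_zero hk0
  have h2 : 2 * (R * (1/2) ^ k) = R * (1/2) ^ j := by rw [hj, pow_succ]; ring
  have hle : R * (1/2) ^ k ≤ R := by
    have : ((1:ℝ)/2) ^ k ≤ 1 := pow_le_one₀ (by norm_num) (by norm_num)
    nlinarith
  refine ⟨R * (1/2) ^ k, hpos k, hle, (Metric.closedBall_subset_closedBall hle).trans hsub, hspec.le, ?_⟩
  rw [h2]
  exact not_lt.1 (hmin j (by omega))

lemma step (hb : LocallyIntegrable b volume) (hB : Bmo b) {t : ℝ} (ht : 0 ≤ t) {s : ℝ≥0∞}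
    (hs : ∀ c R, 0 < R → volume {x ∈ Metric.closedBall c R | t ≤ ‖b x - m b c R‖} ≤ s * V n R)
    (c : Fin n → ℝ) {R : ℝ} (hR : 0 < R) :
    volume {x ∈ Metric.closedBall c R | t + A n ≤ ‖b x - m b c R‖} ≤ s * (1/2) * V n R := by
  classical
  set a := m b c R with ha
  have hloc : LocallyIntegrable (fun y => ‖b y - a‖) volume := by
    have h : LocallyIntegrable (fun y => b y - a) volume := hb.sub (locallyIntegrable_const a)
    exact fun x => (h x).norm
  have hLeb := IsUnifLocDoublingMeasure.ae_tendsto_average (μ := (volume : Measure (Fin n → ℝ))) hloc 1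
  have hLeb' : ∀ᵐ x : Fin n → ℝ, Tendsto (fun r => ⨍ y in Metric.closedBall x r, ‖b y - a‖) (𝓝[>] 0) (𝓝 ‖b x - a‖) := by
    filter_upwards [hLeb] with x hx
    refine hx (fun _ => x) id tendsto_id ?_
    filter_upwards [self_mem_nhdsWithin] with r hr
    rw [mem_Ioi] at hr
    simpa using hr.le
  set D : Set (Fin n → ℝ) := {x | x ∈ Metric.closedBall c R ∧ t + A n ≤ ‖b x - a‖ ∧
    Tendsto (fun r => ⨍ y in Metric.closedBall x r, ‖b y - a‖) (𝓝[>] 0) (𝓝 ‖b x - a‖)}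
  have hAK : K n < A n := by unfold A; have : (0:ℝ) < (3/2)^n := by positivity
                             linarith
  have hD : volume {x ∈ Metric.closedBall c R | t + A n ≤ ‖b x - a‖} ≤ volume D := by
    apply measure_mono_ae
    filter_upwards [hLeb'] with x hx h
    exact ⟨h.1, h.2, hx⟩
  refine hD.trans ?_
  have hrad : ∀ x : Fin n → ℝ, ∃ r, x ∈ D → (0 < r ∧ r ≤ R ∧ Metric.closedBall x r ⊆ Metric.closedBall c (2 * R) ∧
      ENNReal.ofReal (K n) * V n r ≤ ∫⁻ y in Metric.closedBall x r, ‖b y - m b c R‖ₑ ∧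
      ∫⁻ y in Metric.closedBall x (2 * r), ‖b y - m b c R‖ₑ ≤ ENNReal.ofReal (K n) * V n (2 * r)) := by
    intro x
    by_cases hx : x ∈ D
    · obtain ⟨r, hr⟩ := radius hb hB c hR x hx.1 hx.2.2 (by linarith [hx.2.1])
      exact ⟨r, fun _ => hr⟩
    · exact ⟨0, fun h => absurd h hx⟩
  choose ρ hρ using hrad
  obtain ⟨u, huD, hdisj, hcov⟩ := Vitali.exists_disjoint_subfamily_covering_enlargement
    (fun x => Metric.closedBall x (ρ x)) D ρ 2 (by norm_num) (fun x hx => (hρ x hx).1.le) R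
    (fun x hx => (hρ x hx).2.1) (fun x hx => ⟨x, Metric.mem_closedBall_self (hρ x hx).1.le⟩)
  have hcount : u.Countable := by
    refine hdisj.countable_of_nonempty_interior ?_
    intro x hx
    refine ⟨x, ?_⟩
    have := Metric.ball_subset_interior_closedBall (x := x) (ε := ρ x)
    exact this (Metric.mem_ball_self (hρ x (huD hx)).1)
  have hsubset : D ⊆ ⋃ y ∈ u, {x ∈ Metric.closedBall y (3 * ρ y) | t ≤ ‖b x - m b y (3 * ρ y)‖} := by
    intro x hx
    obtain ⟨y, hy, ⟨z, hz1, hz2⟩, hle⟩ := hcov x hx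
    simp only [mem_iUnion]
    obtain ⟨hp, -, -, -, h5⟩ := hρ y (huD hy)
    refine ⟨y, hy, ?_, ?_⟩
    · rw [Metric.mem_closedBall] at *
      have := dist_triangle x z y
      rw [dist_comm x z] at this
      linarith
    · have e1 : ‖m b y (2 * ρ y) - m b y (3 * ρ y)‖ ≤ (3/2) ^ n := by
        have := m_diff hb hB y y (r := 2 * ρ y) (s := 3/2) (by positivity) (by norm_num)
          (Metric.closedBall_subset_closedBall (by linarith))
        rw [show 3 / 2 * (2 * ρ y) = 3 * ρ y by ring, ← ofReal_norm,
          ENNReal.ofReal_le_ofReal_iff (by positivity)] at this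
        exact this
      have e2 : ‖m b y (2 * ρ y) - a‖ ≤ K n := by
        have := (m_sub hb y (r := 2 * ρ y) (by positivity) a).trans h5
        rw [ENNReal.mul_le_mul_iff_left (V_pos (by positivity)).ne' V_ne_top, ← ofReal_norm,
          ENNReal.ofReal_le_ofReal_iff K_pos.le] at this
        exact this
      have e3 := hx.2.1
      have e4 : ‖b x - a‖ ≤ ‖b x - m b y (3 * ρ y)‖ + ‖m b y (2 * ρ y) - m b y (3 * ρ y)‖ + ‖m b y (2 * ρ y) - a‖ := by
        have : b x - a = (b x - m b y (3 * ρ y)) - (m b y (2 * ρ y) - m b y (3 * ρ y)) + (m b y (2 * ρ y) - a) := by ring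
        rw [this]
        exact (norm_add_le _ _).trans (by gcongr; exact norm_sub_le _ _)
      unfold A at e3
      linarith
  have hK0 : ENNReal.ofReal (K n) ≠ 0 := by simpa using K_pos
  have hsum : ENNReal.ofReal (K n) * ∑' y : u, V n (ρ y) ≤ ENNReal.ofReal (2 ^ n * (1 + 2 ^ n)) * V n R := by
    rw [← ENNReal.tsum_mul_left]
    calc ∑' y : u, ENNReal.ofReal (K n) * V n (ρ y)
        ≤ ∑' y : u, ∫⁻ x in Metric.closedBall (y : Fin n → ℝ) (ρ y), ‖b x - a‖ₑ :=
          ENNReal.tsum_le_tsum fun y => (hρ y (huD y.2)).2.2.2.1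
      _ = ∫⁻ x in ⋃ y ∈ u, Metric.closedBall (y : Fin n → ℝ) (ρ y), ‖b x - a‖ₑ := by
          rw [lintegral_biUnion hcount (fun _ _ => Metric.isClosed_closedBall.measurableSet) hdisj]
      _ ≤ ∫⁻ x in Metric.closedBall c (2 * R), ‖b x - a‖ₑ := by
          apply lintegral_mono_set
          exact iUnion₂_subset fun y hy => (hρ y (huD hy)).2.2.1
      _ ≤ _ := double hb hB c hR
  calc volume D ≤ volume (⋃ y ∈ u, {x ∈ Metric.closedBall y (3 * ρ y) | t ≤ ‖b x - m b y (3 * ρ y)‖}) := measure_mono hsubset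
    _ ≤ ∑' y : u, volume {x ∈ Metric.closedBall (y : Fin n → ℝ) (3 * ρ y) | t ≤ ‖b x - m b y (3 * ρ y)‖} :=
        measure_biUnion_le _ hcount _
    _ ≤ ∑' y : u, s * ENNReal.ofReal (3 ^ n) * V n (ρ y) := by
        refine ENNReal.tsum_le_tsum fun y => ?_
        have hp := (hρ y (huD y.2)).1
        refine (hs y (3 * ρ y) (by positivity)).trans ?_
        rw [V_mul (by norm_num), mul_assoc]
    _ = s * (ENNReal.ofReal (3 ^ n) * ∑' y : u, V n (ρ y)) := by rw [ENNReal.tsum_mul_left, mul_assoc]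
    _ ≤ s * ((1/2) * V n R) := by
        gcongr s * ?_
        rw [← ENNReal.mul_le_mul_iff_right hK0 ENNReal.ofReal_ne_top]
        calc ENNReal.ofReal (K n) * (ENNReal.ofReal (3 ^ n) * ∑' y : u, V n (ρ y))
            = ENNReal.ofReal (3 ^ n) * (ENNReal.ofReal (K n) * ∑' y : u, V n (ρ y)) := by ring
          _ ≤ ENNReal.ofReal (3 ^ n) * (ENNReal.ofReal (2 ^ n * (1 + 2 ^ n)) * V n R) := by gcongr
          _ = ENNReal.ofReal (K n) * ((1/2) * V n R) := by
            rw [← mul_assoc, ← mul_assoc, ← ENNReal.ofReal_mul (by positivity),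
              show (1/2 : ℝ≥0∞) = ENNReal.ofReal (1/2) by
                rw [ENNReal.ofReal_div_of_pos (by norm_num)]; simp, ← ENNReal.ofReal_mul K_pos.le]
            congr 2
            unfold K; ring
    _ = _ := by rw [mul_assoc]

lemma A_pos : 0 < A n := by unfold A; have := K_pos (n := n); positivity

lemma decay (hb : LocallyIntegrable b volume) (hB : Bmo b) (k : ℕ) : ∀ (c : Fin n → ℝ) (R : ℝ), 0 < R →
    volume {x ∈ Metric.closedBall c R | k * A n ≤ ‖b x - m b c R‖} ≤ (1/2) ^ k * V n R := by
  induction k with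
  | zero =>
    intro c R hR
    rw [pow_zero, one_mul, ← vol_ball c hR.le]
    exact measure_mono fun x hx => hx.1
  | succ k ih =>
    intro c R hR
    have := step hb hB (t := k * A n) (by have := A_pos (n := n); positivity) ih c hR
    rw [pow_succ]
    convert this using 5
    push_cast; ring_nf

lemma moment (n : ℕ) (L : ℝ) (hL : 0 ≤ L) (N : ℕ) : ∃ C : ℝ, 0 < C ∧ ∀ b : (Fin n → ℝ) → ℝ,
    LocallyIntegrable b volume → Bmo b → ∀ (c : Fin n → ℝ) (R : ℝ), 0 < R →
    ∫⁻ x in Metric.closedBall c R, ENNReal.ofReal ((L + ‖b x - m b c R‖) ^ N) ≤ ENNReal.ofReal C * V n R := by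
  have hA := A_pos (n := n)
  have hsm : Summable (fun k : ℕ => (L + (k + 1) * A n) ^ N * (1/2 : ℝ) ^ k) := by
    have h1 := (summable_pow_mul_geometric_of_norm_lt_one (R := ℝ) N (r := 1/2) (by norm_num))
    have h2 := ((summable_nat_add_iff 1).2 h1).mul_left (2 * (L + A n) ^ N)
    refine Summable.of_nonneg_of_le (fun k => by positivity) (fun k => ?_) h2
    have : (L + (k + 1) * A n) ^ N ≤ ((L + A n) * (k + 1)) ^ N := by
      gcongr
      have : (0:ℝ) ≤ L * k := by positivity
      linarith
    calc _ ≤ ((L + A n) * (k + 1)) ^ N * (1/2 : ℝ) ^ k := by gcongr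
      _ = _ := by rw [mul_pow, pow_succ]; push_cast; ring
  refine ⟨(∑' k : ℕ, (L + (k + 1) * A n) ^ N * (1/2 : ℝ) ^ k) + 1, ?_, ?_⟩
  · have : 0 ≤ ∑' k : ℕ, (L + (k + 1) * A n) ^ N * (1/2 : ℝ) ^ k := tsum_nonneg fun k => by positivity
    linarith
  intro b hb hB c R hR
  set a := m b c R with ha
  set S : ℕ → Set (Fin n → ℝ) := fun k => {x | k * A n ≤ ‖b x - a‖}
  have hmeas : AEStronglyMeasurable b (volume.restrict (Metric.closedBall c R)) := (intOn hb c R).aestronglyMeasurable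
  have hS : ∀ k, NullMeasurableSet (S k) (volume.restrict (Metric.closedBall c R)) := fun k =>
    nullMeasurableSet_le aemeasurable_const ((hmeas.aemeasurable.sub_const a).norm)
  calc ∫⁻ x in Metric.closedBall c R, ENNReal.ofReal ((L + ‖b x - a‖) ^ N)
      ≤ ∫⁻ x in Metric.closedBall c R, ∑' k : ℕ, (S k).indicator (fun _ => ENNReal.ofReal ((L + (k + 1) * A n) ^ N)) x := by
        apply lintegral_mono
        intro x
        simp only
        set k := ⌊‖b x - a‖ / A n⌋₊
        have hk : x ∈ S k := by
          have := Nat.floor_le (a := ‖b x - a‖ / A n) (by positivity)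
          rw [le_div_iff₀ hA] at this
          exact this
        have hk2 : ‖b x - a‖ ≤ (k + 1) * A n := by
          have := (Nat.lt_floor_add_one (‖b x - a‖ / A n)).le
          rw [div_le_iff₀ hA] at this
          exact this
        refine le_trans ?_ (ENNReal.le_tsum k)
        rw [indicator_of_mem hk]
        gcongr
    _ = ∑' k : ℕ, ∫⁻ x in Metric.closedBall c R, (S k).indicator (fun _ => ENNReal.ofReal ((L + (k + 1) * A n) ^ N)) x :=
        lintegral_tsum fun k => aemeasurable_const.indicator₀ (hS k)
    _ ≤ ∑' k : ℕ, ENNReal.ofReal ((L + (k + 1) * A n) ^ N * (1/2 : ℝ) ^ k) * V n R := by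
        refine ENNReal.tsum_le_tsum fun k => ?_
        rw [lintegral_indicator_const₀ (hS k), Measure.restrict_apply₀ (hS k), ENNReal.ofReal_mul (by positivity), mul_assoc]
        gcongr
        have := decay hb hB k c R hR
        rw [ENNReal.ofReal_pow (by norm_num), ENNReal.ofReal_div_of_pos (by norm_num)]
        simp only [ENNReal.ofReal_one, ENNReal.ofReal_ofNat]
        refine le_trans (measure_mono ?_) this
        exact fun x hx => ⟨hx.2, hx.1⟩
    _ ≤ _ := by
        rw [ENNReal.tsum_mul_right, ← ENNReal.ofReal_tsum_of_nonneg (fun k => by positivity) hsm]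
        gcongr
        linarith

lemma moment2 (n : ℕ) (M : ℝ) (hM : 1 ≤ M) (N : ℕ) : ∃ C : ℝ, 0 < C ∧ ∀ b : (Fin n → ℝ) → ℝ,
    LocallyIntegrable b volume → Bmo b → ∀ (c : Fin n → ℝ) (R : ℝ), 0 < R →
    ∫⁻ x in Metric.closedBall c (M * R), ENNReal.ofReal ((1 + |b x - m b c R|) ^ N) ≤ ENNReal.ofReal C * V n R := by
  obtain ⟨C, hC, h⟩ := moment n (1 + M ^ n) (by positivity) N
  refine ⟨C * M ^ n, by positivity, fun b hb hB c R hR => ?_⟩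
  have := h b hb hB c (M * R) (by positivity)
  rw [V_mul (by positivity), ← mul_assoc, ← ENNReal.ofReal_mul hC.le] at this
  refine le_trans (lintegral_mono fun x => ?_) this
  have h1 := m_diff hb hB c c hR (s := M) (by positivity) (Metric.closedBall_subset_closedBall (by nlinarith))
  rw [← ofReal_norm, ENNReal.ofReal_le_ofReal_iff (by positivity)] at h1
  simp only [Real.norm_eq_abs] at *
  have h2 : |b x - m b c R| ≤ |b x - m b c (M * R)| + |m b c R - m b c (M * R)| := by
    have : b x - m b c R = (b x - m b c (M * R)) - (m b c R - m b c (M * R)) := by ring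
    rw [this]; exact abs_sub _ _
  gcongr ENNReal.ofReal (?_ ^ N)
  linarith
end JN

namespace JN

lemma cube_eq (n : ℕ) (c : Rn n) {d : ℝ} (hd : 0 < d) :
    cube n c d = (WithLp.ofLp : Rn n → (Fin n → ℝ)) ⁻¹' Metric.closedBall (WithLp.ofLp c) (d / 2) := by
  ext x
  simp only [cube, mem_ofPred_eq, mem_preimage, Metric.mem_closedBall]
  rw [dist_pi_le_iff (by positivity)]
  simp only [Real.dist_eq]

lemma emb (n : ℕ) : MeasurableEmbedding (WithLp.ofLp : Rn n → (Fin n → ℝ)) :=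
  (MeasurableEquiv.toLp 2 (Fin n → ℝ)).symm.measurableEmbedding

lemma pres (n : ℕ) : MeasurePreserving (WithLp.ofLp : Rn n → (Fin n → ℝ)) :=
  PiLp.volume_preserving_ofLp (Fin n)

lemma meas_cube (n : ℕ) (c : Rn n) {d : ℝ} (hd : 0 < d) : MeasurableSet (cube n c d) := by
  rw [cube_eq n c hd]; exact (emb n).measurable Metric.isClosed_closedBall.measurableSet

lemma vol_cube (n : ℕ) (c : Rn n) {d : ℝ} (hd : 0 < d) : volume (cube n c d) = ENNReal.ofReal (d ^ n) := by
  rw [cube_eq n c hd, (pres n).measure_preimage_emb (emb n), vol_ball _ (by positivity), V]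
  congr 2; ring

lemma volr_cube (n : ℕ) (c : Rn n) {d : ℝ} (hd : 0 < d) : volume.real (cube n c d) = d ^ n := by
  rw [measureReal_def, vol_cube n c hd, ENNReal.toReal_ofReal (by positivity)]

lemma cube_int (n : ℕ) (c : Rn n) {d : ℝ} (hd : 0 < d) (h : Rn n → ℝ) :
    ∫ x in cube n c d, h x = ∫ x in Metric.closedBall (WithLp.ofLp c) (d / 2), h (WithLp.toLp 2 x) := by
  rw [cube_eq n c hd]
  exact (pres n).setIntegral_preimage_emb (emb n) (fun x => h (WithLp.toLp 2 x)) _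

lemma cube_lint (n : ℕ) (c : Rn n) {d : ℝ} (hd : 0 < d) (h : Rn n → ℝ≥0∞) :
    ∫⁻ x in cube n c d, h x = ∫⁻ x in Metric.closedBall (WithLp.ofLp c) (d / 2), h (WithLp.toLp 2 x) := by
  rw [cube_eq n c hd]
  exact (pres n).setLIntegral_comp_preimage_emb (emb n) (fun x => h (WithLp.toLp 2 x)) _

lemma avg_eq (n : ℕ) (b : Rn n → ℝ) (c : Rn n) {d : ℝ} (hd : 0 < d) :
    cubeAvg n b c d = m (fun x => b (WithLp.toLp 2 x)) (WithLp.ofLp c) (d / 2) := by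
  unfold cubeAvg m
  rw [setAverage_eq, setAverage_eq, cube_int n c hd, volr_cube n c hd, measureReal_def,
    vol_ball _ (by positivity), V, ENNReal.toReal_ofReal (by positivity)]
  congr 3; ring

lemma loc (n : ℕ) (b : Rn n → ℝ) (hb : LocallyIntegrable b volume) :
    LocallyIntegrable (fun x : Fin n → ℝ => b (WithLp.toLp 2 x)) volume := by
  rw [locallyIntegrable_iff]
  intro k hk
  rw [← (pres n).integrableOn_comp_preimage (emb n)]
  have : IsCompact ((WithLp.ofLp : Rn n → (Fin n → ℝ)) ⁻¹' k) :=
    (PiLp.homeomorph 2 (fun _ : Fin n => ℝ)).isCompact_preimage.2 hk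
  exact hb.integrableOn_isCompact this

lemma cubeIntOn (n : ℕ) (b : Rn n → ℝ) (hb : LocallyIntegrable b volume) (c : Rn n) {d : ℝ} (hd : 0 < d) :
    IntegrableOn b (cube n c d) volume := by
  rw [cube_eq n c hd]
  exact hb.integrableOn_isCompact
    ((PiLp.homeomorph 2 (fun _ : Fin n => ℝ)).isCompact_preimage.2 (isCompact_closedBall _ _))

lemma osc_le (n : ℕ) (b : Rn n → ℝ) (h1 : bmoNorm n b = 1) (c : Rn n) {d : ℝ} (hd : 0 < d) :
    osc n b c d ≤ 1 := by
  have hbdd : BddAbove (range fun cd : Rn n × {d : ℝ // 0 < d} => osc n b cd.1 cd.2.1) := by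
    by_contra h
    have := Real.iSup_of_not_bddAbove h
    unfold bmoNorm at h1
    rw [this] at h1
    norm_num at h1
  rw [← h1]
  exact le_ciSup hbdd (c, ⟨d, hd⟩)

lemma bmo (n : ℕ) (b : Rn n → ℝ) (hb : LocallyIntegrable b volume) (h1 : bmoNorm n b = 1) :
    Bmo (fun x : Fin n → ℝ => b (WithLp.toLp 2 x)) := by
  intro c r hr
  have hd : 0 < 2 * r := by positivity
  have h := osc_le n b h1 (WithLp.toLp 2 c) hd
  have e : 2 * r / 2 = r := by ring
  have key := cube_lint n (WithLp.toLp 2 c) hd (fun x => ‖b x - cubeAvg n b (WithLp.toLp 2 c) (2 * r)‖ₑ)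
  rw [avg_eq n b _ hd, e] at key
  simp only at key
  rw [← key]
  set a := m (fun x => b (WithLp.toLp 2 x)) c r with ha
  have hfin : IsFiniteMeasure (volume.restrict (cube n (WithLp.toLp 2 c) (2 * r))) :=
    ⟨by simp [vol_cube n _ hd]⟩
  have hi : Integrable (fun y => b y - a) (volume.restrict (cube n (WithLp.toLp 2 c) (2 * r))) :=
    (cubeIntOn n b hb _ hd).sub (integrable_const a)
  rw [← ofReal_integral_norm_eq_lintegral_enorm hi, V]
  apply ENNReal.ofReal_le_ofReal
  unfold osc at h
  rw [avg_eq n b _ hd, e, setAverage_eq, volr_cube n _ hd, smul_eq_mul, inv_mul_le_iff₀ (by positivity), mul_one] at h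
  exact h

lemma cube_moment (n : ℕ) (M : ℝ) (hM : 1 ≤ M) (N : ℕ) : ∃ C : ℝ, 0 < C ∧ ∀ b : Rn n → ℝ,
    LocallyIntegrable b volume → bmoNorm n b = 1 → ∀ (c : Rn n) (d : ℝ), 0 < d →
    ∫⁻ x in cube n c (M * d), ENNReal.ofReal ((1 + |b x - cubeAvg n b c d|) ^ N) ≤ ENNReal.ofReal (C * d ^ n) := by
  obtain ⟨C, hC, h⟩ := moment2 n M hM N
  refine ⟨C, hC, fun b hb h1 c d hd => ?_⟩
  have := h _ (loc n b hb) (bmo n b hb h1) (WithLp.ofLp c) (d / 2) (by positivity)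
  rw [cube_lint n c (by positivity), avg_eq n b c hd, mul_div_assoc]
  refine this.trans (le_of_eq ?_)
  rw [V, ENNReal.ofReal_mul hC.le]
  congr 3; ring

lemma kernel_bound (n : ℕ) (hn : 0 < n) (s : ℝ) (hs : 0 ≤ s) (hsn : s < n) : ∃ C : ℝ, 0 < C ∧
    ∀ (x c : Rn n) (d : ℝ), 0 < d →
    ∫⁻ y in cube n c d, ENNReal.ofReal (‖x - y‖ ^ (-s)) ≤ ENNReal.ofReal (C * (d ^ n * d ^ (-s))) := by
  have hfr : Module.finrank ℝ (Rn n) = n := by simp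
  have hint : ∀ r : ℝ, IntegrableOn (fun u : Rn n => ‖u‖ ^ (-s)) (Metric.ball 0 r) volume := by
    intro r
    refine integrableOn_ball_of_norm_le_rpow (C := 1) (α := s) (by rw [hfr]; exact hn) (by rw [hfr]; exact hsn) ?_ ?_
    · refine Eventually.of_forall fun u => ?_
      rw [one_mul, Real.norm_of_nonneg (by positivity)]
    · exact (measurable_norm.pow_const _).aestronglyMeasurable
  set J := ∫ u : Rn n in Metric.ball 0 1, ‖u‖ ^ (-s)
  have hJ : 0 ≤ J := integral_nonneg fun _ => by positivity
  refine ⟨1 + J, by positivity, fun x c d hd => ?_⟩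
  have hball : ∫⁻ u : Rn n in Metric.ball 0 d, ENNReal.ofReal (‖u‖ ^ (-s)) = ENNReal.ofReal (d ^ n * d ^ (-s) * J) := by
    rw [← ofReal_integral_eq_lintegral_ofReal (hint d) (Eventually.of_forall fun u => by positivity)]
    congr 1
    have h := Measure.setIntegral_comp_smul_of_pos (volume : Measure (Rn n)) (fun u : Rn n => ‖u‖ ^ (-s)) (Metric.ball 0 1) hd
    rw [hfr, smul_unitBall_of_pos hd] at h
    simp only [norm_smul, Real.norm_of_nonneg hd.le] at h
    simp_rw [Real.mul_rpow hd.le (norm_nonneg _)] at h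
    rw [integral_const_mul, smul_eq_mul] at h
    rw [mul_assoc, h]
    field_simp
  calc ∫⁻ y in cube n c d, ENNReal.ofReal (‖x - y‖ ^ (-s))
      = ∫⁻ y, (cube n c d).indicator (fun y => ENNReal.ofReal (‖x - y‖ ^ (-s))) y :=
        (lintegral_indicator (meas_cube n c hd) _).symm
    _ ≤ ∫⁻ y, ((cube n c d).indicator (fun _ => ENNReal.ofReal (d ^ (-s))) y +
          (Metric.ball (0 : Rn n) d).indicator (fun u => ENNReal.ofReal (‖u‖ ^ (-s))) (x - y)) := by
        apply lintegral_mono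
        intro y
        simp only
        by_cases hy : y ∈ cube n c d
        · rw [indicator_of_mem hy, indicator_of_mem hy]
          by_cases hxy : ‖x - y‖ < d
          · rw [indicator_of_mem (by simpa using hxy)]
            exact le_add_self
          · push Not at hxy
            refine le_trans ?_ le_self_add
            apply ENNReal.ofReal_le_ofReal
            exact Real.rpow_le_rpow_of_nonpos hd hxy (by linarith)
        · rw [indicator_of_notMem hy]; exact zero_le
    _ = ENNReal.ofReal (d ^ (-s)) * ENNReal.ofReal (d ^ n) + ENNReal.ofReal (d ^ n * d ^ (-s) * J) := by
        rw [lintegral_add_left (measurable_const.indicator (meas_cube n c hd)),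
          lintegral_indicator_const (meas_cube n c hd), vol_cube n c hd,
          lintegral_sub_left_eq_self (fun u => (Metric.ball (0 : Rn n) d).indicator (fun u => ENNReal.ofReal (‖u‖ ^ (-s))) u) x,
          lintegral_indicator Metric.isOpen_ball.measurableSet, hball]
    _ = _ := by
        rw [← ENNReal.ofReal_mul (by positivity), ← ENNReal.ofReal_add (by positivity) (by positivity)]
        congr 1; ring

lemma mix (n : ℕ) (hn : 0 < n) (s : ℝ) (hs : 0 ≤ s) (hsn : s < n) : ∃ C : ℝ, 0 < C ∧
    ∀ b : Rn n → ℝ, LocallyIntegrable b volume → bmoNorm n b = 1 → ∀ (x c : Rn n) (d : ℝ), 0 < d →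
    ∫⁻ y in cube n c d, ENNReal.ofReal ((1 + |b y - cubeAvg n b c d|) * ‖x - y‖ ^ (-s))
      ≤ ENNReal.ofReal (C * (d ^ n * d ^ (-s))) := by
  have hn' : (0:ℝ) < n := by exact_mod_cast hn
  -- choose `N`
  obtain ⟨N, hN⟩ := exists_nat_gt (max 1 (n / (n - s)))
  have hN1 : (1:ℝ) < N := (le_max_left _ _).trans_lt hN
  have hN2 : n / (n - s) < (N:ℝ) := (le_max_right _ _).trans_lt hN
  rw [div_lt_iff₀ (by linarith)] at hN2
  set r' : ℝ := N / (N - 1)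
  have hr' : (N:ℝ).HolderConjugate r' := Real.HolderConjugate.conjExponent hN1
  have hr0 : 0 < r' := hr'.symm.pos
  have hsr : s * r' < n := by
    change s * (N / (N - 1)) < n
    rw [mul_div_assoc', div_lt_iff₀ (by linarith)]
    linarith
  obtain ⟨C1, hC1, h1⟩ := cube_moment n 1 le_rfl N
  obtain ⟨C2, hC2, h2⟩ := kernel_bound n hn (s * r') (by positivity) hsr
  refine ⟨C1 ^ (1 / (N:ℝ)) * C2 ^ (1 / r'), by positivity, fun b hb hb1 x c d hd => ?_⟩
  have e1 := h1 b hb hb1 c d hd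
  rw [one_mul] at e1
  have e2 := h2 x c d hd
  set a := cubeAvg n b c d
  have hmb : AEMeasurable b (volume.restrict (cube n c d)) := hb.aestronglyMeasurable.aemeasurable.restrict
  have hol := ENNReal.lintegral_mul_le_Lp_mul_Lq (volume.restrict (cube n c d)) hr'
    (f := fun y => ENNReal.ofReal (1 + |b y - a|)) (g := fun y => ENNReal.ofReal (‖x - y‖ ^ (-s)))
    (((hmb.sub_const a).abs.const_add 1).ennreal_ofReal)
    (by fun_prop)
  have s1 : ∀ y, ENNReal.ofReal (1 + |b y - a|) ^ (N:ℝ) = ENNReal.ofReal ((1 + |b y - a|) ^ N) := fun y => by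
    rw [ENNReal.rpow_natCast, ENNReal.ofReal_pow (by positivity)]
  have s2 : ∀ y, ENNReal.ofReal (‖x - y‖ ^ (-s)) ^ r' = ENNReal.ofReal (‖x - y‖ ^ (-(s * r'))) := fun y => by
    rw [ENNReal.ofReal_rpow_of_nonneg (by positivity) hr0.le, ← Real.rpow_mul (norm_nonneg _)]
    congr 2; ring
  simp only [s1, s2, Pi.mul_apply] at hol
  have s3 : ∀ y, ENNReal.ofReal (1 + |b y - a|) * ENNReal.ofReal (‖x - y‖ ^ (-s)) = ENNReal.ofReal ((1 + |b y - a|) * ‖x - y‖ ^ (-s)) :=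
    fun y => (ENNReal.ofReal_mul (by positivity)).symm
  simp only [s3] at hol
  refine hol.trans ?_
  calc _ ≤ (ENNReal.ofReal (C1 * d ^ n)) ^ (1 / (N:ℝ)) * (ENNReal.ofReal (C2 * (d ^ n * d ^ (-(s * r'))))) ^ (1 / r') := by gcongr
    _ = _ := by
      rw [ENNReal.ofReal_rpow_of_nonneg (by positivity) (by positivity), ENNReal.ofReal_rpow_of_nonneg (by positivity) (by positivity),
        ← ENNReal.ofReal_mul (by positivity)]
      congr 1
      rw [Real.mul_rpow (by positivity) (by positivity), Real.mul_rpow (by positivity) (by positivity), Real.mul_rpow (by positivity) (by positivity),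
        ← Real.rpow_mul hd.le (-(s * r'))]
      have t1 : -(s * r') * (1 / r') = -s := by field_simp
      have t2 : (d ^ n) ^ (1 / (N:ℝ)) * (d ^ n) ^ (1 / r') = d ^ n := by
        rw [← Real.rpow_add (by positivity)]
        have : 1 / (N:ℝ) + 1 / r' = 1 := by simpa using hr'.inv_add_inv_eq_one
        rw [this, Real.rpow_one]
      rw [t1]
      calc _ = C1 ^ (1 / (N:ℝ)) * C2 ^ (1 / r') * (((d ^ n) ^ (1 / (N:ℝ)) * (d ^ n) ^ (1 / r')) * d ^ (-s)) := by ring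
        _ = _ := by rw [t2]

lemma meas_sign : Measurable Real.sign := by
  unfold Real.sign
  exact Measurable.ite measurableSet_Iio measurable_const (Measurable.ite measurableSet_Ioi measurable_const measurable_const)

lemma abs_sign_le (r : ℝ) : |Real.sign r| ≤ 1 := by
  rcases Real.sign_apply_eq r with h | h | h <;> simp [h]

lemma ker_le (n : ℕ) (α : ℝ) (hα : α < 2 * n) (x y z : Rn n) (hy : y ≠ x) (hz : z ≠ x) :
    fracKernel n α x y z ≤ ‖x - y‖ ^ (-((n : ℝ) - α / 2)) * ‖x - z‖ ^ (-((n : ℝ) - α / 2)) := by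
  unfold fracKernel
  have h1 : 0 < ‖x - y‖ := norm_pos_iff.2 (sub_ne_zero.2 hy.symm)
  have h2 : 0 < ‖x - z‖ := norm_pos_iff.2 (sub_ne_zero.2 hz.symm)
  rw [← Real.mul_rpow h1.le h2.le]
  apply Real.rpow_le_rpow_of_nonpos (by positivity)
  · nlinarith [sq_nonneg (‖x - y‖ - ‖x - z‖), mul_pos h1 h2]
  · linarith

lemma testF_bound (n : ℕ) (p : ℝ) (b : Rn n → ℝ) (c : Rn n) {d : ℝ} (hd : 0 < d) (y : Rn n) :
    |testF n p b c d y| ≤ (cube n c d).indicator (fun _ => 2 * (d ^ n) ^ (-(1 / p))) y := by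
  unfold testF
  by_cases hy : y ∈ cube n c d
  · rw [indicator_of_mem hy, indicator_of_mem hy, abs_mul, abs_of_nonneg (by positivity), mul_comm]
    gcongr
    refine (abs_sub _ _).trans ?_
    have h1 := abs_sign_le (b y - cubeAvg n b c d)
    have h2 : |⨍ z in cube n c d, Real.sign (b z - cubeAvg n b c d)| ≤ 1 := by
      have := norm_setIntegral_le_of_norm_le_const (μ := volume) (s := cube n c d) (C := 1)
        (f := fun z => Real.sign (b z - cubeAvg n b c d)) (by rw [vol_cube n c hd]; simp)
        (fun z _ => abs_sign_le _)
      rw [setAverage_eq, smul_eq_mul, volr_cube n c hd, abs_mul, abs_of_nonneg (by positivity), inv_mul_le_iff₀ (by positivity)]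
      rw [volr_cube n c hd, Real.norm_eq_abs, one_mul] at this
      rwa [mul_one]
    linarith
  · rw [indicator_of_notMem hy, indicator_of_notMem hy]; simp

lemma pointwise (n : ℕ) (hn : 0 < n) (p₁ p₂ q α : ℝ) (hα₀ : 0 < α) (hα₂ : α < 2 * n)
    (hq : 1 / q = 1 / p₁ + 1 / p₂ - α / n) :
    ∃ C : ℝ, 0 < C ∧ ∀ b : Rn n → ℝ, LocallyIntegrable b volume → bmoNorm n b = 1 →
      ∀ (c : Rn n) (d : ℝ), 0 < d → ∀ x,
      |commI n α b (testF n p₁ b c d) (testG n p₂ c d) x| ≤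
        C * (d ^ n) ^ (-(1 / q)) * (1 + |b x - cubeAvg n b c d|) := by
  have hn' : (0:ℝ) < n := by exact_mod_cast hn
  set s : ℝ := n - α / 2 with hs
  obtain ⟨C, hC, hmix⟩ := mix n hn s (by linarith) (by linarith)
  refine ⟨2 * C ^ 2, by positivity, fun b hb hb1 c d hd x => ?_⟩
  have hQ := hmix b hb hb1 x c d hd
  set a := cubeAvg n b c d
  set f := testF n p₁ b c d with hf
  set g := testG n p₂ c d with hg
  set w1 := (d ^ n) ^ (-(1 / p₁))
  set w2 := (d ^ n) ^ (-(1 / p₂))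
  have hw1 : 0 < w1 := by positivity
  have hw2 : 0 < w2 := by positivity
  set B := C * (d ^ n * d ^ (-s)) with hBdef
  have hBpos : 0 < B := by positivity
  have hnt : Nontrivial (Rn n) := by
    apply Module.nontrivial_of_finrank_pos (R := ℝ); simpa using hn
  have hne : ∀ᵐ y : Rn n, y ≠ x := by
    rw [ae_iff]; simp
  have hmc := meas_cube n c hd
  have hbm : AEStronglyMeasurable b volume := hb.aestronglyMeasurable
  have hphi : ∫⁻ y in cube n c d, ENNReal.ofReal (‖x - y‖ ^ (-s)) ≤ ENNReal.ofReal B := by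
    refine le_trans (lintegral_mono fun y => ENNReal.ofReal_le_ofReal ?_) hQ
    refine le_mul_of_one_le_left (by positivity) ?_
    linarith [abs_nonneg (b y - a)]
  have hgm : Measurable g := measurable_const.indicator hmc
  set H : Rn n → ℝ := fun y => ∫ z, fracKernel n α x y z * g z with hH
  have hKm : Measurable (fun p : Rn n × Rn n => fracKernel n α x p.1 p.2) := by
    unfold fracKernel
    fun_prop
  have hHm : StronglyMeasurable H := by
    have : StronglyMeasurable (fun p : Rn n × Rn n => fracKernel n α x p.1 p.2 * g p.2) :=
      (hKm.mul (hgm.comp measurable_snd)).stronglyMeasurable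
    exact this.integral_prod_right'
  have hHb : ∀ y, y ≠ x → |H y| ≤ w2 * B * ‖x - y‖ ^ (-s) := by
    intro y hy
    have h1 : ‖H y‖ₑ ≤ ENNReal.ofReal (w2 * ‖x - y‖ ^ (-s)) * ENNReal.ofReal B := by
      calc ‖H y‖ₑ ≤ ∫⁻ z, ‖fracKernel n α x y z * g z‖ₑ := enorm_integral_le_lintegral_enorm _
        _ ≤ ∫⁻ z, (cube n c d).indicator (fun z => ENNReal.ofReal (w2 * ‖x - y‖ ^ (-s)) * ENNReal.ofReal (‖x - z‖ ^ (-s))) z := by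
            apply lintegral_mono_ae
            filter_upwards [hne] with z hz
            by_cases hzc : z ∈ cube n c d
            · have hgz : g z = w2 := by rw [hg]; unfold testG; rw [indicator_of_mem hzc]
              rw [indicator_of_mem hzc, hgz, ← ENNReal.ofReal_mul (by positivity), ← ofReal_norm, Real.norm_eq_abs, abs_mul,
                abs_of_nonneg hw2.le, abs_of_nonneg (by unfold fracKernel; positivity)]
              apply ENNReal.ofReal_le_ofReal
              have := ker_le n α hα₂ x y z hy hz
              rw [← hs] at this
              calc _ ≤ (‖x - y‖ ^ (-s) * ‖x - z‖ ^ (-s)) * w2 := by gcongr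
                _ = _ := by ring
            · have hgz : g z = 0 := by rw [hg]; unfold testG; rw [indicator_of_notMem hzc]
              rw [hgz]; simp
        _ = ENNReal.ofReal (w2 * ‖x - y‖ ^ (-s)) * ∫⁻ z in cube n c d, ENNReal.ofReal (‖x - z‖ ^ (-s)) := by
            rw [lintegral_indicator hmc, lintegral_const_mul' _ _ ENNReal.ofReal_ne_top]
        _ ≤ _ := by gcongr
    rw [← ENNReal.ofReal_mul (by positivity), ← ofReal_norm, ENNReal.ofReal_le_ofReal_iff (by positivity)] at h1
    rw [← Real.norm_eq_abs]
    refine h1.trans (le_of_eq (by ring))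
  have hIop : ∀ F : Rn n → ℝ, Iop n α F g x = ∫ y, F y * H y := by
    intro F
    unfold Iop
    congr 1
    ext y
    rw [hH]
    simp only
    rw [← integral_const_mul]
    congr 1
    ext z
    ring
  have hfm : AEStronglyMeasurable f volume := by
    rw [hf]; unfold testF
    refine AEStronglyMeasurable.indicator ?_ hmc
    have := (meas_sign.comp_aemeasurable (hbm.aemeasurable.sub_const a))
    exact ((this.sub_const _).const_mul _).aestronglyMeasurable
  have key : ∀ β : Rn n → ℝ, AEStronglyMeasurable β volume → (∀ y, |β y| ≤ 1 + |b y - a|) →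
      ∫⁻ y, ‖β y * f y * H y‖ₑ ≤ ENNReal.ofReal (2 * w1 * w2 * B ^ 2) := by
    intro β hβm hβ
    calc ∫⁻ y, ‖β y * f y * H y‖ₑ
        ≤ ∫⁻ y, (cube n c d).indicator (fun y => ENNReal.ofReal (2 * w1 * w2 * B) *
            ENNReal.ofReal ((1 + |b y - a|) * ‖x - y‖ ^ (-s))) y := by
          apply lintegral_mono_ae
          filter_upwards [hne] with y hy
          have hfy := testF_bound n p₁ b c hd y
          by_cases hyc : y ∈ cube n c d
          · rw [indicator_of_mem hyc] at hfy ⊢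
            rw [← ENNReal.ofReal_mul (by positivity), ← ofReal_norm, Real.norm_eq_abs, abs_mul, abs_mul]
            apply ENNReal.ofReal_le_ofReal
            calc _ ≤ (1 + |b y - a|) * (2 * w1) * (w2 * B * ‖x - y‖ ^ (-s)) := by
                  gcongr
                  · exact hβ y
                  · exact hHb y hy
              _ = _ := by ring
          · rw [indicator_of_notMem hyc] at hfy
            have : f y = 0 := by simpa using hfy
            rw [this]; simp
      _ = ENNReal.ofReal (2 * w1 * w2 * B) * ∫⁻ y in cube n c d, ENNReal.ofReal ((1 + |b y - a|) * ‖x - y‖ ^ (-s)) := by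
          rw [lintegral_indicator hmc, lintegral_const_mul' _ _ ENNReal.ofReal_ne_top]
      _ ≤ ENNReal.ofReal (2 * w1 * w2 * B) * ENNReal.ofReal B := by gcongr
      _ = _ := by rw [← ENNReal.ofReal_mul (by positivity)]; congr 1; ring
  have hbnd : ∀ β : Rn n → ℝ, AEStronglyMeasurable β volume → (∀ y, |β y| ≤ 1 + |b y - a|) →
      Integrable (fun y => β y * f y * H y) volume ∧ |∫ y, β y * f y * H y| ≤ 2 * w1 * w2 * B ^ 2 := by
    intro β hβm hβ
    have hk := key β hβm hβ
    refine ⟨⟨(hβm.mul hfm).mul hHm.aestronglyMeasurable, ?_⟩, ?_⟩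
    · exact lt_of_le_of_lt hk ENNReal.ofReal_lt_top
    · have := (enorm_integral_le_lintegral_enorm (μ := volume) (fun y => β y * f y * H y)).trans hk
      rwa [← ofReal_norm, ENNReal.ofReal_le_ofReal_iff (by positivity)] at this
  obtain ⟨i1, k1⟩ := hbnd (fun _ => 1) aestronglyMeasurable_const (fun y => by simp)
  obtain ⟨i2, k2⟩ := hbnd (fun y => b y - a) (hbm.sub aestronglyMeasurable_const) (fun y => by linarith)
  have hcomm : commI n α b f g x = (∫ y, (b y - a) * f y * H y) - (b x - a) * ∫ y, 1 * f y * H y := by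
    unfold commI
    rw [hIop, hIop]
    have e : ∫ y, b y * f y * H y = (∫ y, (b y - a) * f y * H y) + a * ∫ y, 1 * f y * H y := by
      rw [← integral_const_mul, ← integral_add i2 (i1.const_mul a)]
      congr 1; ext y; ring
    rw [e]
    simp only [one_mul]
    ring
  rw [hcomm]
  have hfin : 2 * w1 * w2 * B ^ 2 = 2 * C ^ 2 * (d ^ n) ^ (-(1 / q)) := by
    have hB2 : (d ^ n * d ^ (-s)) ^ 2 = (d ^ n) ^ (α / n) := by
      rw [← Real.rpow_natCast d n, ← Real.rpow_add hd, ← Real.rpow_natCast _ 2, ← Real.rpow_mul hd.le, ← Real.rpow_mul hd.le]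
      congr 1
      rw [hs]; push_cast; field_simp; ring
    have : w1 * w2 * (d ^ n) ^ (α / n) = (d ^ n) ^ (-(1 / q)) := by
      rw [← Real.rpow_add (by positivity), ← Real.rpow_add (by positivity)]
      congr 1; rw [hq]; ring
    rw [hBdef, mul_pow, hB2, ← this]; ring
  calc _ ≤ |∫ y, (b y - a) * f y * H y| + |(b x - a) * ∫ y, 1 * f y * H y| := abs_sub _ _
    _ ≤ 2 * w1 * w2 * B ^ 2 + |b x - a| * (2 * w1 * w2 * B ^ 2) := by
        rw [abs_mul]; gcongr
    _ = _ := by rw [hfin]; ring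

end JN

/-- (Small-set estimate (14).) Given the constants `γ₂ > γ₁ > 2`, `γ₃ > 0`
from the annulus estimates, there exists `0 < β < γ₂`, depending only on
`p₁, p₂, n, α, q, ε`, such that for every real-valued `b` with `‖b‖_{BMO} = 1`, every cube
`Q_j` with `⨍_{Q_j}|b-b_{Q_j}| ≥ ε`, and every measurable
`E ⊆ {γ₁d_j < |x-y_j| < γ₂d_j}` with `|E|/|Q_j| < βⁿ`, one has
`(∫_E |[b,I_α]₁(f_j,g_j)|^q)^{1/q} ≤ γ₃/4`. -/
theorem statement16 (n : ℕ) (hn : 0 < n) (p₁ p₂ q α : ℝ)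
    (hp₁ : 1 < p₁) (hp₂ : 1 < p₂)
    (hα₀ : 0 < α) (hα₂ : α < 2 * n)
    (hαp : α / n < 1 / p₁ + 1 / p₂) (hsum : 1 / p₁ + 1 / p₂ < 2)
    (hq : 1 / q = 1 / p₁ + 1 / p₂ - α / n) (hq' : 1 < q)
    (ε : ℝ) (hε : 0 < ε)
    (γ₁ γ₂ γ₃ : ℝ) (hγ₁ : 2 < γ₁) (hγ₁₂ : γ₁ < γ₂) (hγ₃ : 0 < γ₃)
    (hannulus : ∀ b : Rn n → ℝ, LocallyIntegrable b volume → bmoNorm n b = 1 →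
      ∀ (yj : Rn n) (dj : ℝ), 0 < dj → ε ≤ osc n b yj dj →
        ENNReal.ofReal γ₃ ≤
          (∫⁻ x in {x : Rn n | γ₁ * dj < ‖x - yj‖ ∧ ‖x - yj‖ < γ₂ * dj},
              ENNReal.ofReal
                (|commI n α b (testF n p₁ b yj dj) (testG n p₂ yj dj) x| ^ q)) ^ (1 / q) ∧
        (∫⁻ x in {x : Rn n | γ₂ * dj < ‖x - yj‖},
            ENNReal.ofReal
              (|commI n α b (testF n p₁ b yj dj) (testG n p₂ yj dj) x| ^ q)) ^ (1 / q)
          ≤ ENNReal.ofReal (γ₃ / 4)) :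
    ∃ β : ℝ, 0 < β ∧ β < γ₂ ∧
      ∀ b : Rn n → ℝ, LocallyIntegrable b volume → bmoNorm n b = 1 →
        ∀ (yj : Rn n) (dj : ℝ), 0 < dj → ε ≤ osc n b yj dj →
          ∀ E : Set (Rn n), MeasurableSet E →
            E ⊆ {x : Rn n | γ₁ * dj < ‖x - yj‖ ∧ ‖x - yj‖ < γ₂ * dj} →
            volume E < ENNReal.ofReal (β ^ n * dj ^ n) →
            (∫⁻ x in E,
                ENNReal.ofReal
                  (|commI n α b (testF n p₁ b yj dj) (testG n p₂ yj dj) x| ^ q)) ^ (1 / q)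
              ≤ ENNReal.ofReal (γ₃ / 4) := by
  have hq0 : 0 < q := by linarith
  have hn' : (0:ℝ) < n := by exact_mod_cast hn
  obtain ⟨C, hC, hpt⟩ := JN.pointwise n hn p₁ p₂ q α hα₀ hα₂ hq
  obtain ⟨N, hN⟩ := exists_nat_ge (2 * q)
  obtain ⟨C2, hC2, hmom⟩ := JN.cube_moment n (2 * γ₂) (by linarith) N
  set T : ℝ := (γ₃ / 4) ^ q / (C ^ q * C2 ^ (1 / 2 : ℝ)) with hT
  have hTpos : 0 < T := by positivity
  refine ⟨min 1 (T ^ 2), by positivity, lt_of_le_of_lt (min_le_left _ _) (by linarith), ?_⟩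
  intro b hb hb1 c d hd _ E hE hEsub hvol
  set β := min 1 (T ^ 2)
  have hβ0 : 0 < β := by positivity
  set a := cubeAvg n b c d with ha
  have hmo := hmom b hb hb1 c d hd
  have hEc : E ⊆ cube n c (2 * γ₂ * d) := by
    intro x hx i
    have h1 := (hEsub hx).2
    have h2 := PiLp.norm_apply_le (x - c) i
    rw [Real.norm_eq_abs, PiLp.sub_apply] at h2
    linarith
  have hmb : AEMeasurable b (volume.restrict E) := hb.aestronglyMeasurable.aemeasurable.restrict
  have hCS := ENNReal.lintegral_mul_le_Lp_mul_Lq (volume.restrict E) Real.HolderConjugate.two_two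
    (f := fun _ => 1) (g := fun x => ENNReal.ofReal ((1 + |b x - a|) ^ q))
    aemeasurable_const ((((hmb.sub_const a).abs.const_add 1).pow_const q).ennreal_ofReal)
  have h2 : ∫⁻ x in E, ENNReal.ofReal ((1 + |b x - a|) ^ q) ^ (2:ℝ) ≤ ENNReal.ofReal (C2 * d ^ n) := by
    refine le_trans ?_ hmo
    refine le_trans (lintegral_mono fun x => ?_) (lintegral_mono_set hEc)
    simp only
    rw [ENNReal.ofReal_rpow_of_nonneg (by positivity) (by norm_num)]
    apply ENNReal.ofReal_le_ofReal
    rw [← Real.rpow_mul (by positivity), ← Real.rpow_natCast]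
    apply Real.rpow_le_rpow_of_exponent_le
    · linarith [abs_nonneg (b x - a)]
    · linarith
  have h3 : ∫⁻ x in E, ENNReal.ofReal ((1 + |b x - a|) ^ q) ≤ ENNReal.ofReal (d ^ n * (C2 ^ (1 / 2 : ℝ) * T)) := by
    simp only [Pi.mul_apply, one_mul, ENNReal.one_rpow, lintegral_const, MeasurableSet.univ, Measure.restrict_apply, univ_inter] at hCS
    refine hCS.trans ?_
    calc _ ≤ (ENNReal.ofReal (β ^ n * d ^ n)) ^ (1 / 2 : ℝ) * (ENNReal.ofReal (C2 * d ^ n)) ^ (1 / 2 : ℝ) := by gcongr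
      _ = ENNReal.ofReal ((β ^ n) ^ (1 / 2 : ℝ) * C2 ^ (1 / 2 : ℝ) * d ^ n) := by
        rw [ENNReal.ofReal_rpow_of_nonneg (by positivity) (by positivity), ENNReal.ofReal_rpow_of_nonneg (by positivity) (by positivity),
          ← ENNReal.ofReal_mul (by positivity), Real.mul_rpow (by positivity) (by positivity), Real.mul_rpow (by positivity) (by positivity)]
        congr 1
        have : (d ^ n) ^ (1 / 2 : ℝ) * (d ^ n) ^ (1 / 2 : ℝ) = d ^ n := by
          rw [← Real.rpow_add (by positivity)]; norm_num
        calc _ = (β ^ n) ^ (1 / 2 : ℝ) * C2 ^ (1 / 2 : ℝ) * ((d ^ n) ^ (1 / 2 : ℝ) * (d ^ n) ^ (1 / 2 : ℝ)) := by ring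
          _ = _ := by rw [this]
      _ ≤ _ := by
        apply ENNReal.ofReal_le_ofReal
        have hβT : (β ^ n) ^ (1 / 2 : ℝ) ≤ T := by
          have hle : β ^ n ≤ T ^ 2 := (pow_le_of_le_one hβ0.le (min_le_left _ _) hn.ne').trans (min_le_right _ _)
          calc (β ^ n) ^ (1 / 2 : ℝ) ≤ (T ^ 2) ^ (1 / 2 : ℝ) := by gcongr
            _ = T := by rw [← Real.sqrt_eq_rpow, Real.sqrt_sq hTpos.le]
        calc _ ≤ T * C2 ^ (1 / 2 : ℝ) * d ^ n := by gcongr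
          _ = _ := by ring
  have h4 : ∫⁻ x in E, ENNReal.ofReal (|commI n α b (testF n p₁ b c d) (testG n p₂ c d) x| ^ q)
      ≤ ENNReal.ofReal ((γ₃ / 4) ^ q) := by
    calc _ ≤ ∫⁻ x in E, ENNReal.ofReal (C ^ q * (d ^ n)⁻¹) * ENNReal.ofReal ((1 + |b x - a|) ^ q) := by
          apply lintegral_mono
          intro x
          simp only
          rw [← ENNReal.ofReal_mul (by positivity)]
          apply ENNReal.ofReal_le_ofReal
          calc _ ≤ (C * (d ^ n) ^ (-(1 / q)) * (1 + |b x - a|)) ^ q := by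
                gcongr
                exact hpt b hb hb1 c d hd x
            _ = _ := by
              rw [Real.mul_rpow (by positivity) (by positivity), Real.mul_rpow (by positivity) (by positivity),
                ← Real.rpow_mul (by positivity), show -(1 / q) * q = -1 by field_simp, Real.rpow_neg_one]
      _ = ENNReal.ofReal (C ^ q * (d ^ n)⁻¹) * ∫⁻ x in E, ENNReal.ofReal ((1 + |b x - a|) ^ q) :=
          lintegral_const_mul' _ _ ENNReal.ofReal_ne_top
      _ ≤ ENNReal.ofReal (C ^ q * (d ^ n)⁻¹) * ENNReal.ofReal (d ^ n * (C2 ^ (1 / 2 : ℝ) * T)) := by gcongr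
      _ = _ := by
          rw [← ENNReal.ofReal_mul (by positivity), hT]
          congr 1
          have : 0 < C ^ q := by positivity
          have : 0 < C2 ^ (1 / 2 : ℝ) := by positivity
          field_simp
  calc _ ≤ (ENNReal.ofReal ((γ₃ / 4) ^ q)) ^ (1 / q) := by gcongr
    _ = _ := by
      rw [ENNReal.ofReal_rpow_of_nonneg (by positivity) (by positivity), ← Real.rpow_mul (by positivity),
        mul_one_div_cancel hq0.ne', Real.rpow_one]
end

section
/- Let 1<p₁,p₂<∞, 0<α<2n, α/n < 1/p₁ + 1/p₂ < 2, and 1/q = 1/p₁ + 1/p₂ − α/n with 1<q<∞. Let b be a real-valued BMO function with ‖b‖_{BMO} = 1 such that for some ε>0 there is a sequence of cubes {Q_j} with |Q_j| → 0 as j → ∞ and ⨍_{Q_j}|b − b_{Q_j}| ≥ ε for every j. Then there exist sequences {f_j} bounded in L^{p₁}(ℝⁿ) and {g_j} bounded in L^{p₂}(ℝⁿ) and a constant c>0 such that ‖[b,I_α]₁(f_j,g_j) − [b,I_α]₁(f_k,g_k)‖_{L^q} ≥ c for all j ≠ k; in particular [b,I_α]₁ is not compact from L^{p₁} × L^{p₂}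 to L^q. -/
open MeasureTheory Set Filter
open scoped ENNReal BigOperators Topology

lemma cube_eq (n : ℕ) (c : Rn n) (d : ℝ) :
    cube n c d = (@WithLp.ofLp 2 (Fin n → ℝ)) ⁻¹'
      Icc (fun i => c i - d / 2) (fun i => c i + d / 2) := by
  ext x
  simp only [cube, mem_setOf_eq, mem_preimage, mem_Icc, Pi.le_def]
  constructor
  · intro h
    exact ⟨fun i => by have := abs_le.1 (h i); linarith, fun i => by have := abs_le.1 (h i); linarith⟩
  · rintro ⟨h1, h2⟩ i
    exact abs_le.2 ⟨by have := h1 i; linarith, by have := h2 i; linarith⟩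

lemma measurableSet_cube (n : ℕ) (c : Rn n) (d : ℝ) : MeasurableSet (cube n c d) := by
  rw [cube_eq]
  exact (PiLp.volume_preserving_ofLp (Fin n)).measurable measurableSet_Icc

lemma volume_cube (n : ℕ) (c : Rn n) (d : ℝ) (hd : 0 ≤ d) :
    volume (cube n c d) = ENNReal.ofReal (d ^ n) := by
  rw [cube_eq, (PiLp.volume_preserving_ofLp (Fin n)).measure_preimage
    measurableSet_Icc.nullMeasurableSet, Real.volume_Icc_pi]
  simp [ENNReal.ofReal_pow hd]

lemma volReal_cube (n : ℕ) (c : Rn n) (d : ℝ) (hd : 0 ≤ d) :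
    volume.real (cube n c d) = d ^ n := by
  rw [Measure.real, volume_cube n c d hd, ENNReal.toReal_ofReal (by positivity)]

lemma cube_dist_sq (n : ℕ) (c : Rn n) (d : ℝ) (hd : 0 ≤ d) (x y : Rn n)
    (hx : x ∈ cube n c d) (hy : y ∈ cube n c d) : ‖x - y‖ ^ 2 ≤ n * d ^ 2 := by
  rw [EuclideanSpace.norm_sq_eq]
  have : ∀ i ∈ (Finset.univ : Finset (Fin n)), ‖(x - y) i‖ ^ 2 ≤ d ^ 2 := by
    intro i _
    have h1 := abs_le.1 (hx i)
    have h2 := abs_le.1 (hy i)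
    have : ‖(x - y) i‖ ≤ d := by
      simp only [PiLp.sub_apply, Real.norm_eq_abs]
      exact abs_le.2 ⟨by linarith, by linarith⟩
    gcongr
  calc _ ≤ ∑ i : Fin n, d ^ 2 := Finset.sum_le_sum this
    _ = _ := by simp

lemma cube_norm_le (n : ℕ) (c : Rn n) (d : ℝ) (hd : 0 ≤ d) (x : Rn n)
    (hx : x ∈ cube n c d) : ‖x‖ ≤ ‖c‖ + (n + 1) * d := by
  have hc : c ∈ cube n c d := fun i => by simp; linarith
  have h := cube_dist_sq n c d hd x c hx hc
  have h2 : ‖x - c‖ ≤ (n + 1) * d := by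
    refine abs_le_of_sq_le_sq' ?_ (by positivity) |>.2
    nlinarith [sq_nonneg d, (Nat.cast_nonneg n : (0:ℝ) ≤ n), mul_nonneg (Nat.cast_nonneg n : (0:ℝ) ≤ n) (sq_nonneg d), mul_nonneg (mul_nonneg (Nat.cast_nonneg n : (0:ℝ) ≤ n) (Nat.cast_nonneg n : (0:ℝ) ≤ n)) (sq_nonneg d)]
  calc ‖x‖ = ‖c + (x - c)‖ := by congr 1; abel
    _ ≤ ‖c‖ + ‖x - c‖ := norm_add_le _ _
    _ ≤ _ := by linarith

lemma integrableOn_cube (n : ℕ) (b : Rn n → ℝ) (hb : LocallyIntegrable b volume)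
    (c : Rn n) (d : ℝ) (hd : 0 ≤ d) : IntegrableOn b (cube n c d) volume := by
  refine (hb.integrableOn_isCompact
    (isCompact_closedBall (0 : Rn n) (‖c‖ + (n + 1) * d))).mono_set ?_
  intro x hx
  simpa using cube_norm_le n c d hd x hx

/-- The local part of the product kernel. -/
noncomputable def kap (n : ℕ) (γ : ℝ) : Rn n → ℝ :=
  fun w => indicator (Iio (1:ℝ)) (fun r => r ^ (-γ)) ‖w‖

lemma kap_nonneg (n : ℕ) (γ : ℝ) (w : Rn n) : 0 ≤ kap n γ w := by
  unfold kap indicator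
  split_ifs <;> positivity

lemma integrable_kap (n : ℕ) (hn : 0 < n) (γ : ℝ) (hγ : γ < n) :
    Integrable (kap n γ) volume := by
  haveI : Nonempty (Fin n) := ⟨⟨0, hn⟩⟩
  unfold kap
  rw [integrable_fun_norm_addHaar (volume : Measure (Rn n))
    (f := indicator (Iio (1:ℝ)) (fun r : ℝ => r ^ (-γ)))]
  have h1 : IntegrableOn (fun r : ℝ => r ^ ((n:ℝ) - 1 - γ)) (Ioo 0 1) volume := by
    rw [intervalIntegral.integrableOn_Ioo_rpow_iff (by norm_num)]
    linarith
  have h2 : (fun y : ℝ => y ^ (Module.finrank ℝ (Rn n) - 1) •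
      indicator (Iio (1:ℝ)) (fun r : ℝ => r ^ (-γ)) y) =
      indicator (Iio (1:ℝ)) (fun y : ℝ => y ^ (Module.finrank ℝ (Rn n) - 1) * y ^ (-γ)) := by
    ext y
    by_cases hy : y < 1 <;> simp [indicator, hy]
  rw [h2, IntegrableOn, integrable_indicator_iff measurableSet_Iio, IntegrableOn,
    Measure.restrict_restrict measurableSet_Iio]
  have h3 : Iio (1:ℝ) ∩ Ioi 0 = Ioo 0 1 := by ext; simp [and_comm]
  rw [h3]
  refine (integrableOn_congr_fun ?_ measurableSet_Ioo).1 h1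
  intro y hy
  have hy0 : 0 < y := hy.1
  simp only [finrank_euclideanSpace, Fintype.card_fin]
  rw [← Real.rpow_natCast, ← Real.rpow_add hy0, Nat.cast_sub hn]
  congr 1
  push_cast; ring

/-- Dominating function. -/
noncomputable def Hf (n : ℕ) (γ : ℝ) (c : Rn n) (d : ℝ) (x y : Rn n) : ℝ :=
  indicator (cube n c d) (fun _ => (1:ℝ)) y + kap n γ (x - y)

lemma integrable_ind_cube (n : ℕ) (c : Rn n) (d : ℝ) (hd : 0 ≤ d) :
    Integrable (indicator (cube n c d) (fun _ => (1:ℝ))) volume := by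
  rw [integrable_indicator_iff (measurableSet_cube n c d)]
  refine integrableOn_const ?_
  rw [volume_cube n c d hd]; exact ENNReal.ofReal_ne_top

lemma integrable_Hf (n : ℕ) (hn : 0 < n) (γ : ℝ) (hγ : γ < n) (c : Rn n) (d : ℝ) (hd : 0 ≤ d)
    (x : Rn n) : Integrable (Hf n γ c d x) volume :=
  (integrable_ind_cube n c d hd).add ((integrable_kap n hn γ hγ).comp_sub_left x)

lemma integral_Hf (n : ℕ) (hn : 0 < n) (γ : ℝ) (hγ : γ < n) (c : Rn n) (d : ℝ) (hd : 0 ≤ d)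
    (x : Rn n) : ∫ y, Hf n γ c d x y = d ^ n + ∫ w, kap n γ w := by
  unfold Hf
  rw [integral_add (integrable_ind_cube n c d hd) ((integrable_kap n hn γ hγ).comp_sub_left x),
    integral_sub_left_eq_self, integral_indicator (measurableSet_cube n c d)]
  simp [volReal_cube n c d hd]

lemma Hf_nonneg (n : ℕ) (γ : ℝ) (c : Rn n) (d : ℝ) (x y : Rn n) : 0 ≤ Hf n γ c d x y := by
  unfold Hf
  have := kap_nonneg n γ (x - y)
  have : 0 ≤ indicator (cube n c d) (fun _ => (1:ℝ)) y := indicator_nonneg (fun _ _ => zero_le_one) _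
  linarith

lemma rad_bound (n : ℕ) (γ : ℝ) (hγ0 : 0 < γ) (c : Rn n) (d : ℝ) (hd : 0 ≤ d) (x y : Rn n)
    (hy : y ∈ cube n c d) (hxy : y ≠ x) :
    ‖x - y‖ ^ (-γ) ≤
      (2 + (‖c‖ + (n + 1) * d)) ^ γ * (1 + ‖x‖) ^ (-γ) * Hf n γ c d x y := by
  have hR := cube_norm_le n c d hd y hy
  set R := ‖c‖ + (n + 1) * d with hRdef
  have hR0 : 0 ≤ R := by positivity
  have hr : 0 < ‖x - y‖ := by rw [norm_pos_iff, sub_ne_zero]; exact hxy.symm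
  set r := ‖x - y‖ with hrdef
  have hx : ‖x‖ ≤ r + ‖y‖ := by
    calc ‖x‖ = ‖(x - y) + y‖ := by congr 1; abel
      _ ≤ _ := norm_add_le _ _
  have hxp : 0 < 1 + ‖x‖ := by positivity
  have hH : Hf n γ c d x y = 1 + kap n γ (x - y) := by
    simp [Hf, indicator, hy]
  have key : (1 + ‖x‖) ^ γ * r ^ (-γ) ≤ (2 + R) ^ γ * Hf n γ c d x y := by
    rw [hH]
    by_cases h1 : r < 1
    · have hk : kap n γ (x - y) = r ^ (-γ) := by
        simp [kap, indicator, ← hrdef, h1]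
      rw [hk]
      have : (1 + ‖x‖) ^ γ ≤ (2 + R) ^ γ := Real.rpow_le_rpow hxp.le (by linarith) hγ0.le
      have h3 : 0 ≤ r ^ (-γ) := by positivity
      have h4 : 0 ≤ (2 + R) ^ γ := by positivity
      nlinarith [mul_le_mul_of_nonneg_right this h3]
    · have hk := kap_nonneg n γ (x - y)
      have h4 : 0 ≤ (2 + R) ^ γ := by positivity
      have : (1 + ‖x‖) ^ γ * r ^ (-γ) ≤ (2 + R) ^ γ := by
        rw [Real.rpow_neg hr.le, ← div_eq_mul_inv, ← Real.div_rpow hxp.le hr.le]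
        refine Real.rpow_le_rpow (by positivity) ?_ hγ0.le
        rw [div_le_iff₀ hr]
        push Not at h1
        nlinarith
      nlinarith [mul_nonneg h4 hk]
  rw [Real.rpow_neg hxp.le]
  have hp : 0 < (1 + ‖x‖) ^ γ := by positivity
  rw [mul_comm ((2 + R) ^ γ), mul_assoc, inv_mul_eq_div, le_div_iff₀ hp]
  linarith

lemma fracKernel_le (n : ℕ) (α : ℝ) (hγ0 : 0 < (n:ℝ) - α / 2) (x y z : Rn n) (hy : y ≠ x)
    (hz : z ≠ x) :
    fracKernel n α x y z ≤ ‖x - y‖ ^ (-((n : ℝ) - α / 2)) * ‖x - z‖ ^ (-((n : ℝ) - α / 2)) := by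
  have h1 : 0 < ‖x - y‖ := by rw [norm_pos_iff, sub_ne_zero]; exact hy.symm
  have h2 : 0 < ‖x - z‖ := by rw [norm_pos_iff, sub_ne_zero]; exact hz.symm
  rw [fracKernel, ← Real.mul_rpow h1.le h2.le]
  refine Real.rpow_le_rpow_of_nonpos (by positivity) ?_ (by linarith)
  nlinarith [sq_nonneg (‖x - y‖ - ‖x - z‖)]

lemma fracKernel_nonneg (n : ℕ) (α : ℝ) (x y z : Rn n) : 0 ≤ fracKernel n α x y z := by
  unfold fracKernel; positivity

lemma fracKernel_ge (n : ℕ) (α : ℝ) (hγ0 : 0 < (n:ℝ) - α / 2) (c : Rn n) (d : ℝ) (hd : 0 ≤ d)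
    (x y z : Rn n) (hx : x ∈ cube n c d) (hy : y ∈ cube n c d) (hz : z ∈ cube n c d)
    (hxy : y ≠ x) :
    (2 * n * d ^ 2) ^ (-((n : ℝ) - α / 2)) ≤ fracKernel n α x y z := by
  have h1 : 0 < ‖x - y‖ := by rw [norm_pos_iff, sub_ne_zero]; exact hxy.symm
  refine Real.rpow_le_rpow_of_nonpos (by positivity) ?_ (by linarith)
  have := cube_dist_sq n c d hd x y hx hy
  have := cube_dist_sq n c d hd x z hx hz
  linarith

lemma ae_ne_pt (n : ℕ) (hn : 0 < n) (x : Rn n) : ∀ᵐ y ∂(volume : Measure (Rn n)), y ≠ x := by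
  haveI : Nonempty (Fin n) := ⟨⟨0, hn⟩⟩
  rw [ae_iff]
  simp

lemma kernel_dom (n : ℕ) (α : ℝ) (hγ0 : 0 < (n:ℝ) - α / 2) (c : Rn n) (d : ℝ) (hd : 0 ≤ d)
    (x y z : Rn n) (hy : y ∈ cube n c d) (hz : z ∈ cube n c d) (hxy : y ≠ x) (hxz : z ≠ x) :
    fracKernel n α x y z ≤
      ((2 + (‖c‖ + (n + 1) * d)) ^ ((n:ℝ) - α / 2)) ^ 2 *
        ((1 + ‖x‖) ^ (-((n:ℝ) - α / 2))) ^ 2 *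
        (Hf n ((n:ℝ) - α / 2) c d x y * Hf n ((n:ℝ) - α / 2) c d x z) := by
  refine (fracKernel_le n α hγ0 x y z hxy hxz).trans ?_
  have h1 := rad_bound n _ hγ0 c d hd x y hy hxy
  have h2 := rad_bound n _ hγ0 c d hd x z hz hxz
  refine (mul_le_mul h1 h2 (by positivity) ?_).trans (le_of_eq (by ring))
  have := Hf_nonneg n ((n:ℝ) - α / 2) c d x y
  positivity

/-- The pointwise constant in the bounds. -/
noncomputable def Dc (n : ℕ) (α : ℝ) (c : Rn n) (d : ℝ) (x : Rn n) : ℝ :=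
  ((2 + (‖c‖ + (n + 1) * d)) ^ ((n:ℝ) - α / 2)) ^ 2 *
        ((1 + ‖x‖) ^ (-((n:ℝ) - α / 2))) ^ 2

lemma Dc_nonneg (n : ℕ) (α : ℝ) (c : Rn n) (d : ℝ) (x : Rn n) : 0 ≤ Dc n α c d x := by
  unfold Dc; positivity

lemma integrand_dom (n : ℕ) (α : ℝ) (hγ0 : 0 < (n:ℝ) - α / 2) (c : Rn n)
    (d : ℝ) (hd : 0 ≤ d) (f g : Rn n → ℝ) (A B : ℝ)
    (hf : ∀ y, |f y| ≤ indicator (cube n c d) (fun _ => A) y)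
    (hg : ∀ y, |g y| ≤ indicator (cube n c d) (fun _ => B) y)
    (hA : 0 ≤ A) (hB : 0 ≤ B) (x y z : Rn n) (hxy : y ≠ x) (hxz : z ≠ x) :
    ‖fracKernel n α x y z * (f y * g z)‖ ≤
      (A * B * Dc n α c d x * Hf n ((n:ℝ) - α / 2) c d x y) * Hf n ((n:ℝ) - α / 2) c d x z := by
  have h1 := Hf_nonneg n ((n:ℝ) - α / 2) c d x y
  have h2 := Hf_nonneg n ((n:ℝ) - α / 2) c d x z
  have h3 := Dc_nonneg n α c d x
  have hR : 0 ≤ (A * B * Dc n α c d x * Hf n ((n:ℝ) - α / 2) c d x y) *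
    Hf n ((n:ℝ) - α / 2) c d x z := by positivity
  have hf' := hf y
  have hg' := hg z
  by_cases hy : y ∈ cube n c d
  · by_cases hz : z ∈ cube n c d
    · have hk := kernel_dom n α hγ0 c d hd x y z hy hz hxy hxz
      rw [indicator_of_mem hy] at hf'
      rw [indicator_of_mem hz] at hg'
      rw [norm_mul, norm_mul, Real.norm_of_nonneg (fracKernel_nonneg n α x y z), Real.norm_eq_abs,
        Real.norm_eq_abs]
      calc _ ≤ (Dc n α c d x * (Hf n ((n:ℝ) - α / 2) c d x y *
              Hf n ((n:ℝ) - α / 2) c d x z)) * (A * B) := by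
            refine mul_le_mul hk (mul_le_mul hf' hg' (abs_nonneg _) hA) (by positivity)
              (by positivity)
        _ = _ := by ring
    · rw [indicator_of_notMem hz] at hg'
      have : g z = 0 := abs_nonpos_iff.1 hg'
      simpa [this] using hR
  · rw [indicator_of_notMem hy] at hf'
    have : f y = 0 := abs_nonpos_iff.1 hf'
    simpa [this] using hR

lemma inner_bound (n : ℕ) (hn : 0 < n) (α : ℝ) (hα : 0 < α) (hγ0 : 0 < (n:ℝ) - α / 2) (c : Rn n)
    (d : ℝ) (hd : 0 ≤ d) (f g : Rn n → ℝ) (A B : ℝ)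
    (hf : ∀ y, |f y| ≤ indicator (cube n c d) (fun _ => A) y)
    (hg : ∀ y, |g y| ≤ indicator (cube n c d) (fun _ => B) y)
    (hA : 0 ≤ A) (hB : 0 ≤ B) (x y : Rn n) (hxy : y ≠ x) :
    ‖∫ z, fracKernel n α x y z * (f y * g z)‖ ≤
      (A * B * Dc n α c d x * (d ^ n + ∫ w, kap n ((n:ℝ) - α / 2) w)) *
        Hf n ((n:ℝ) - α / 2) c d x y := by
  have hγ : (n:ℝ) - α / 2 < n := by linarith
  refine (norm_integral_le_of_norm_le
    (((integrable_Hf n hn _ hγ c d hd x).const_mul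
      (A * B * Dc n α c d x * Hf n ((n:ℝ) - α / 2) c d x y))) ?_).trans ?_
  · filter_upwards [ae_ne_pt n hn x] with z hz
    exact integrand_dom n α hγ0 c d hd f g A B hf hg hA hB x y z hxy hz
  · rw [integral_const_mul, integral_Hf n hn _ hγ c d hd]
    exact le_of_eq (by ring)

lemma Iop_bound (n : ℕ) (hn : 0 < n) (α : ℝ) (hα : 0 < α) (hγ0 : 0 < (n:ℝ) - α / 2) (c : Rn n)
    (d : ℝ) (hd : 0 ≤ d) (f g : Rn n → ℝ) (A B : ℝ)
    (hf : ∀ y, |f y| ≤ indicator (cube n c d) (fun _ => A) y)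
    (hg : ∀ y, |g y| ≤ indicator (cube n c d) (fun _ => B) y)
    (hA : 0 ≤ A) (hB : 0 ≤ B) (x : Rn n) :
    |Iop n α f g x| ≤
      (A * B * Dc n α c d x * (d ^ n + ∫ w, kap n ((n:ℝ) - α / 2) w)) *
        (d ^ n + ∫ w, kap n ((n:ℝ) - α / 2) w) := by
  have hγ : (n:ℝ) - α / 2 < n := by linarith
  unfold Iop
  rw [← Real.norm_eq_abs]
  refine (norm_integral_le_of_norm_le
    (((integrable_Hf n hn _ hγ c d hd x).const_mul
      (A * B * Dc n α c d x * (d ^ n + ∫ w, kap n ((n:ℝ) - α / 2) w)))) ?_).trans ?_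
  · filter_upwards [ae_ne_pt n hn x] with y hy
    exact inner_bound n hn α hα hγ0 c d hd f g A B hf hg hA hB x y hy
  · rw [integral_const_mul, integral_Hf n hn _ hγ c d hd]

/-- Upper bound for the commutator. -/
lemma comm_upper (n : ℕ) (hn : 0 < n) (α : ℝ) (hα : 0 < α) (hγ0 : 0 < (n:ℝ) - α / 2) (c : Rn n)
    (d : ℝ) (hd : 0 ≤ d) (b f g : Rn n → ℝ) (A A' B : ℝ)
    (hf : ∀ y, |f y| ≤ indicator (cube n c d) (fun _ => A) y)
    (hbf : ∀ y, |b y * f y| ≤ indicator (cube n c d) (fun _ => A') y)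
    (hg : ∀ y, |g y| ≤ indicator (cube n c d) (fun _ => B) y)
    (hA : 0 ≤ A) (hA' : 0 ≤ A') (hB : 0 ≤ B) :
    ∃ C : ℝ, 0 ≤ C ∧ ∀ x, |commI n α b f g x| ≤
      C * (1 + |b x|) * (1 + ‖x‖) ^ (-(2 * n - α)) := by
  set S := d ^ n + ∫ w, kap n ((n:ℝ) - α / 2) w with hS
  have hS0 : 0 ≤ S := by
    have : 0 ≤ ∫ w, kap n ((n:ℝ) - α / 2) w := integral_nonneg (kap_nonneg n _)
    positivity
  set D0 := ((2 + (‖c‖ + (n + 1) * d)) ^ ((n:ℝ) - α / 2)) ^ 2 with hD0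
  have hD : ∀ x, Dc n α c d x = D0 * (1 + ‖x‖) ^ (-(2 * n - α)) := by
    intro x
    unfold Dc
    rw [← hD0, ← Real.rpow_natCast (_ ^ (-((n:ℝ) - α / 2))), ← Real.rpow_mul (by positivity)]
    congr 2
    push_cast; ring
  have hD00 : 0 ≤ D0 := by positivity
  refine ⟨(A + A') * B * D0 * S * S, by positivity, fun x => ?_⟩
  have h1 := Iop_bound n hn α hα hγ0 c d hd f g A B hf hg hA hB x
  have h2 := Iop_bound n hn α hα hγ0 c d hd (fun y => b y * f y) g A' B hbf hg hA' hB x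
  rw [← hS, hD x] at h1 h2
  have hP : 0 ≤ (1 + ‖x‖) ^ (-(2 * n - α)) := by positivity
  set P := (1 + ‖x‖) ^ (-(2 * n - α))
  unfold commI
  calc _ ≤ |Iop n α (fun y => b y * f y) g x| + |b x * Iop n α f g x| := abs_sub _ _
    _ ≤ A' * B * (D0 * P) * S * S + |b x| * (A * B * (D0 * P) * S * S) := by
      rw [abs_mul]; gcongr
    _ ≤ _ := by
      have e1 : 0 ≤ A * B * (D0 * P) * S * S := by positivity
      have e2 : 0 ≤ |b x| * (A' * B * (D0 * P) * S * S) := by positivity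
      nlinarith

lemma measurable_fracKernel (n : ℕ) (α : ℝ) (x : Rn n) :
    Measurable (fun p : Rn n × Rn n => fracKernel n α x p.1 p.2) := by
  unfold fracKernel
  fun_prop

lemma outer_integrable (n : ℕ) (hn : 0 < n) (α : ℝ) (hα : 0 < α) (hγ0 : 0 < (n:ℝ) - α / 2)
    (c : Rn n) (d : ℝ) (hd : 0 ≤ d) (f g : Rn n → ℝ) (A B : ℝ)
    (hfm : AEStronglyMeasurable f volume) (hgm : AEStronglyMeasurable g volume)
    (hf : ∀ y, |f y| ≤ indicator (cube n c d) (fun _ => A) y)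
    (hg : ∀ y, |g y| ≤ indicator (cube n c d) (fun _ => B) y)
    (hA : 0 ≤ A) (hB : 0 ≤ B) (x : Rn n) :
    Integrable (fun y => ∫ z, fracKernel n α x y z * (f y * g z)) volume := by
  have hγ : (n:ℝ) - α / 2 < n := by linarith
  refine ((integrable_Hf n hn _ hγ c d hd x).const_mul
      (A * B * Dc n α c d x * (d ^ n + ∫ w, kap n ((n:ℝ) - α / 2) w))).mono' ?_ ?_
  · refine AEStronglyMeasurable.integral_prod_right'
      (f := fun p : Rn n × Rn n => fracKernel n α x p.1 p.2 * (f p.1 * g p.2)) ?_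
    exact (measurable_fracKernel n α x).aestronglyMeasurable.mul
      (hfm.comp_fst.mul hgm.comp_snd)
  · filter_upwards [ae_ne_pt n hn x] with y hy
    exact inner_bound n hn α hα hγ0 c d hd f g A B hf hg hA hB x y hy

/-- Lower bound for the commutator. -/
lemma comm_lower (n : ℕ) (hn : 0 < n) (α : ℝ) (hα : 0 < α) (hγ0 : 0 < (n:ℝ) - α / 2)
    (c : Rn n) (d : ℝ) (hd : 0 ≤ d) (b f : Rn n → ℝ) (A A' B m : ℝ)
    (hfm : AEStronglyMeasurable f volume) (hbm : AEStronglyMeasurable b volume)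
    (hf : ∀ y, |f y| ≤ indicator (cube n c d) (fun _ => A) y)
    (hbf : ∀ y, |b y * f y| ≤ indicator (cube n c d) (fun _ => A') y)
    (hA : 0 ≤ A) (hA' : 0 ≤ A') (hB : 0 ≤ B)
    (hf0 : ∀ y, 0 ≤ f y) (hfb : ∀ y, 0 ≤ (b y - m) * f y)
    (x : Rn n) (hx : x ∈ cube n c d) (hbx : b x ≤ m) :
    (2 * n * d ^ 2) ^ (-((n : ℝ) - α / 2)) * B * d ^ n * ∫ y, (b y - m) * f y ≤
      commI n α b f (indicator (cube n c d) (fun _ => B)) x := by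
  have hγ : (n:ℝ) - α / 2 < n := by linarith
  set g : Rn n → ℝ := indicator (cube n c d) (fun _ => B) with hgdef
  have hg0 : ∀ z, 0 ≤ g z := fun z => indicator_nonneg (fun _ _ => hB) z
  have hg : ∀ y, |g y| ≤ indicator (cube n c d) (fun _ => B) y := fun y => by
    rw [abs_of_nonneg (hg0 y)]
  have hgm : AEStronglyMeasurable g volume :=
    (measurable_const.indicator (measurableSet_cube n c d)).aestronglyMeasurable
  have i1 := outer_integrable n hn α hα hγ0 c d hd f g A B hfm hgm hf hg hA hB x
  have i2 := outer_integrable n hn α hα hγ0 c d hd (fun y => b y * f y) g A' B (hbm.mul hfm) hgm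
    hbf hg hA' hB x
  have e : ∀ (a : ℝ) (y : Rn n), ∫ z, fracKernel n α x y z * (a * g z) =
      a * ∫ z, fracKernel n α x y z * g z := by
    intro a y
    rw [← integral_const_mul]
    congr 1; ext z; ring
  have e1 : commI n α b f g x =
      ∫ y, (b y - b x) * f y * ∫ z, fracKernel n α x y z * g z := by
    unfold commI Iop
    rw [← integral_const_mul, ← integral_sub i2 (i1.const_mul _)]
    congr 1; ext y
    rw [e, e]; ring
  have i3 : Integrable (fun y => (b y - b x) * f y * ∫ z, fracKernel n α x y z * g z) volume := by
    refine (i2.sub (i1.const_mul (b x))).congr (Eventually.of_forall fun y => ?_)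
    simp only [Pi.sub_apply]
    rw [e, e]; ring
  rw [e1, ← integral_const_mul]
  have hK0 : 0 ≤ (2 * n * d ^ 2 : ℝ) ^ (-((n : ℝ) - α / 2)) := by positivity
  refine integral_mono_of_nonneg (Eventually.of_forall fun y => ?_) i3 ?_
  · have := hfb y
    simp only [Pi.zero_apply]
    positivity
  · filter_upwards [ae_ne_pt n hn x] with y hy
    have hPhi0 : 0 ≤ ∫ z, fracKernel n α x y z * g z :=
      integral_nonneg fun z => mul_nonneg (fracKernel_nonneg n α x y z) (hg0 z)
    by_cases hyQ : y ∈ cube n c d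
    · have hPhi : (2 * n * d ^ 2) ^ (-((n : ℝ) - α / 2)) * B * d ^ n ≤
          ∫ z, fracKernel n α x y z * g z := by
        have hdom := integrand_dom n α hγ0 c d hd (indicator (cube n c d) (fun _ => 1)) g 1 B
          (fun y => by rw [abs_of_nonneg (indicator_nonneg (fun _ _ => zero_le_one) _)]) hg
          zero_le_one hB x y
        have iz : Integrable (fun z => fracKernel n α x y z * g z) volume := by
          refine ((integrable_Hf n hn _ hγ c d hd x).const_mul
            (1 * B * Dc n α c d x * Hf n ((n:ℝ) - α / 2) c d x y)).mono' ?_ ?_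
          · exact (((measurable_fracKernel n α x).comp
              (measurable_const.prodMk measurable_id)).aestronglyMeasurable (f := fun z => fracKernel n α x y z)).mul hgm
          · filter_upwards [ae_ne_pt n hn x] with z hz
            have := hdom z hy hz
            rw [indicator_of_mem hyQ, one_mul] at this
            exact this
        calc (2 * n * d ^ 2) ^ (-((n : ℝ) - α / 2)) * B * d ^ n
            = ∫ z, (2 * n * d ^ 2) ^ (-((n : ℝ) - α / 2)) * g z := by
              rw [integral_const_mul, hgdef, integral_indicator (measurableSet_cube n c d)]
              simp [volReal_cube n c d hd]; ring
          _ ≤ _ := by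
            refine integral_mono_of_nonneg (Eventually.of_forall fun z =>
              mul_nonneg hK0 (hg0 z)) iz (Eventually.of_forall fun z => ?_)
            by_cases hz : z ∈ cube n c d
            · exact mul_le_mul_of_nonneg_right
                (fracKernel_ge n α hγ0 c d hd x y z hx hyQ hz hy) (hg0 z)
            · simp [hgdef, hz]
      have h1 : (b y - m) * f y ≤ (b y - b x) * f y :=
        mul_le_mul_of_nonneg_right (by linarith) (hf0 y)
      calc _ ≤ (∫ z, fracKernel n α x y z * g z) * ((b y - m) * f y) :=
            mul_le_mul_of_nonneg_right hPhi (hfb y)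
        _ ≤ (∫ z, fracKernel n α x y z * g z) * ((b y - b x) * f y) :=
            mul_le_mul_of_nonneg_left h1 hPhi0
        _ = _ := mul_comm _ _
    · have hf' := hf y
      rw [indicator_of_notMem hyQ] at hf'
      have : f y = 0 := abs_nonpos_iff.1 hf'
      simp [this]

lemma int_cube (n : ℕ) (b : Rn n → ℝ) (c : Rn n) (d : ℝ) (hd : 0 < d) :
    ∫ x in cube n c d, b x = d ^ n * cubeAvg n b c d := by
  unfold cubeAvg
  rw [setAverage_eq, volReal_cube n c d hd.le, smul_eq_mul, mul_inv_cancel_left₀ (by positivity)]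

lemma int_osc (n : ℕ) (b : Rn n → ℝ) (c : Rn n) (d : ℝ) (hd : 0 < d) :
    ∫ x in cube n c d, |b x - cubeAvg n b c d| = d ^ n * osc n b c d := by
  unfold osc
  rw [setAverage_eq, volReal_cube n c d hd.le, smul_eq_mul, mul_inv_cancel_left₀ (by positivity)]

lemma wNorm_le_one (n : ℕ) (p : ℝ) (hp : 0 < p) (c : Rn n) (d : ℝ) (hd : 0 < d) (f : Rn n → ℝ)
    (hf : ∀ y, |f y| ≤ indicator (cube n c d) (fun _ => (d ^ n) ^ (-(1 / p))) y) :
    wNorm n p (fun _ => 1) f ≤ 1 := by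
  unfold wNorm
  refine ENNReal.rpow_le_one ?_ (by positivity)
  calc ∫⁻ x, ENNReal.ofReal (|f x| ^ p * 1)
      ≤ ∫⁻ x, indicator (cube n c d) (fun _ => ENNReal.ofReal ((d ^ n)⁻¹)) x := by
        refine lintegral_mono fun x => ?_
        have h := hf x
        by_cases hx : x ∈ cube n c d
        · rw [indicator_of_mem hx] at h ⊢
          refine ENNReal.ofReal_le_ofReal ?_
          rw [mul_one]
          refine (Real.rpow_le_rpow (abs_nonneg _) h hp.le).trans (le_of_eq ?_)
          rw [← Real.rpow_mul (by positivity), ← Real.rpow_neg_one]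
          congr 1; field_simp
        · rw [indicator_of_notMem hx] at h
          have : f x = 0 := abs_nonpos_iff.1 h
          simp [this, Real.zero_rpow hp.ne']
    _ = 1 := by
        rw [lintegral_indicator_const (measurableSet_cube n c d), volume_cube n c d hd.le,
          ← ENNReal.ofReal_mul (by positivity), inv_mul_cancel₀ (by positivity),
          ENNReal.ofReal_one]

lemma cheb (n : ℕ) (b : Rn n → ℝ) (hb : LocallyIntegrable b volume) (c : Rn n) (d : ℝ)
    (hd : 0 < d) (ho : osc n b c d ≤ 1) :
    volume (cube n c d ∩ {x | 4 ≤ |b x - cubeAvg n b c d|}) ≤ ENNReal.ofReal (d ^ n / 4) := by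
  have hi : IntegrableOn b (cube n c d) volume := integrableOn_cube n b hb c d hd.le
  have hfin : volume (cube n c d) ≠ ∞ := by
    rw [volume_cube n c d hd.le]; exact ENNReal.ofReal_ne_top
  have hi2 : Integrable (fun x => |b x - cubeAvg n b c d|) (volume.restrict (cube n c d)) :=
    (hi.sub (integrableOn_const hfin)).abs
  have h := mul_meas_ge_le_integral_of_nonneg
    (Eventually.of_forall fun x => abs_nonneg (b x - cubeAvg n b c d)) hi2 4
  rw [int_osc n b c d hd] at h
  have hdn : 0 < d ^ n := by positivity
  have h2 : (volume.restrict (cube n c d)).real {x | 4 ≤ |b x - cubeAvg n b c d|} ≤ d ^ n / 4 := by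
    nlinarith
  rw [measureReal_restrict_apply' (measurableSet_cube n c d), inter_comm, Measure.real] at h2
  rw [← ENNReal.ofReal_toReal (measure_ne_top_of_subset inter_subset_left hfin)]
  exact ENNReal.ofReal_le_ofReal h2

/-- Truncation of the positive part. -/
noncomputable def psi (N : ℕ) : ℝ → ℝ := indicator (Icc 0 (N:ℝ)) (fun _ => 1)

lemma psi_nonneg (N : ℕ) (t : ℝ) : 0 ≤ psi N t := indicator_nonneg (fun _ _ => zero_le_one) t

lemma psi_le_one (N : ℕ) (t : ℝ) : psi N t ≤ 1 := by
  unfold psi indicator; split_ifs <;> norm_num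

lemma psi_mul_nonneg (N : ℕ) (t : ℝ) : 0 ≤ t * psi N t := by
  unfold psi indicator
  split_ifs with h
  · simpa using h.1
  · simp

lemma psi_mul_le (N : ℕ) (t : ℝ) : |t * psi N t| ≤ N := by
  unfold psi indicator
  split_ifs with h
  · rw [mul_one, abs_of_nonneg h.1]; exact h.2
  · simp

lemma psi_abs_mul_le (N : ℕ) (t : ℝ) : |t * psi N t| ≤ |t| := by
  unfold psi indicator
  split_ifs with h <;> simp

lemma measurable_psi (N : ℕ) : Measurable (psi N) := measurable_const.indicator measurableSet_Icc

lemma psi_tendsto (t : ℝ) : Tendsto (fun N => t * psi N t) atTop (𝓝 (max t 0)) := by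
  rcases le_or_gt 0 t with h | h
  · refine tendsto_const_nhds.congr' ?_
    filter_upwards [eventually_ge_atTop ⌈t⌉₊] with N hN
    have : t ∈ Icc (0:ℝ) N := ⟨h, (Nat.le_ceil t).trans (by exact_mod_cast hN)⟩
    rw [psi, indicator_of_mem this, mul_one, max_eq_left h]
  · refine tendsto_const_nhds.congr fun N => ?_
    have : t ∉ Icc (0:ℝ) N := fun h' => absurd h'.1 (not_le.2 h)
    rw [psi, indicator_of_notMem this, mul_zero, max_eq_right h.le]

lemma exists_trunc (n : ℕ) (b : Rn n → ℝ) (hb : LocallyIntegrable b volume) (c : Rn n) (d : ℝ)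
    (hd : 0 < d) (ε : ℝ) (hε : 0 < ε) (ho : ε ≤ osc n b c d) :
    ∃ N : ℕ, d ^ n * (ε / 4) ≤
      ∫ x in cube n c d, (b x - cubeAvg n b c d) * psi N (b x - cubeAvg n b c d) := by
  have hi : IntegrableOn b (cube n c d) volume := integrableOn_cube n b hb c d hd.le
  have hfin : volume (cube n c d) ≠ ∞ := by
    rw [volume_cube n c d hd.le]; exact ENNReal.ofReal_ne_top
  set m := cubeAvg n b c d with hm
  have hi1 : Integrable (fun x => b x - m) (volume.restrict (cube n c d)) :=
    hi.sub (integrableOn_const hfin)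
  have hmax : ∫ x in cube n c d, max (b x - m) 0 = d ^ n * (osc n b c d) / 2 := by
    have e : ∀ x, max (b x - m) 0 = (1/2) * (|b x - m| + (b x - m)) := by
      intro x
      rcases le_total 0 (b x - m) with h | h
      · rw [max_eq_left h, abs_of_nonneg h]; ring
      · rw [max_eq_right h, abs_of_nonpos h]; ring
    simp_rw [e]
    rw [integral_const_mul, integral_add hi1.abs hi1, int_osc n b c d hd,
      integral_sub hi (integrableOn_const hfin), int_cube n b c d hd]
    simp [volReal_cube n c d hd.le, ← hm]
    ring
  have ht : Tendsto (fun N : ℕ => ∫ x in cube n c d, (b x - m) * psi N (b x - m)) atTop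
      (𝓝 (∫ x in cube n c d, max (b x - m) 0)) := by
    refine tendsto_integral_of_dominated_convergence (fun x => |b x - m|) (fun N => ?_) hi1.abs
      (fun N => Eventually.of_forall fun x => psi_abs_mul_le N _)
      (Eventually.of_forall fun x => psi_tendsto _)
    exact (hi1.aemeasurable.mul
      ((measurable_psi N).comp_aemeasurable hi1.aemeasurable)).aestronglyMeasurable
  have hdn : 0 < d ^ n := by positivity
  have hlt : d ^ n * (ε / 4) < ∫ x in cube n c d, max (b x - m) 0 := by
    rw [hmax]; nlinarith [mul_le_mul_of_nonneg_left ho hdn.le, mul_pos hdn hε]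
  obtain ⟨N, hN⟩ := (ht.eventually (lt_mem_nhds hlt)).exists
  exact ⟨N, hN.le⟩

lemma d_arith (n : ℕ) (hn : 0 < n) (p₁ p₂ q α : ℝ)
    (hq : 1 / q = 1 / p₁ + 1 / p₂ - α / n) (d : ℝ) (hd : 0 < d) (ε : ℝ) :
    (2 * n * d ^ 2) ^ (-((n : ℝ) - α / 2)) * (d ^ n) ^ (-(1 / p₂)) * d ^ n *
      ((d ^ n) ^ (-(1 / p₁)) * (d ^ n * (ε / 4))) =
    ((2 * n : ℝ) ^ (-((n : ℝ) - α / 2)) * (ε / 4)) * (d ^ n) ^ (-(1 / q)) := by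
  have hn' : (n:ℝ) ≠ 0 := by positivity
  have e0 : d ^ n = d ^ (n:ℝ) := (Real.rpow_natCast d n).symm
  have e2 : d ^ 2 = d ^ (2:ℝ) := (Real.rpow_natCast d 2).symm
  rw [Real.mul_rpow (by positivity) (by positivity), e0, e2, ← Real.rpow_mul hd.le,
    ← Real.rpow_mul hd.le, ← Real.rpow_mul hd.le, ← Real.rpow_mul hd.le]
  have : d ^ ((n:ℝ) * -(1 / q)) = d ^ (2 * -((n:ℝ) - α / 2)) * d ^ ((n:ℝ) * -(1 / p₂)) *
     d ^ (n:ℝ) * (d ^ ((n:ℝ) * -(1 / p₁)) * d ^ (n:ℝ)) := by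
    rw [← Real.rpow_add hd, ← Real.rpow_add hd, ← Real.rpow_add hd, ← Real.rpow_add hd, hq]
    congr 1
    have : (n:ℝ) * (α / n) = α := by field_simp
    linear_combination this
  rw [this]; ring

/-- The lower-bound constant. -/
noncomputable def c0 (n : ℕ) (α ε : ℝ) : ℝ := (2 * n : ℝ) ^ (-((n : ℝ) - α / 2)) * (ε / 4)

/-- The data extracted from one cube. -/
def CubeData (n : ℕ) (p₁ p₂ q α ε : ℝ) (b : Rn n → ℝ) (c : Rn n) (d : ℝ)
    (f : Rn n → ℝ) (A' : ℝ) (E : Set (Rn n)) : Prop :=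
  NullMeasurableSet E volume ∧ E ⊆ cube n c d ∧ ENNReal.ofReal (d ^ n / 4) ≤ volume E ∧
  (∀ x ∈ E, |b x - cubeAvg n b c d| ≤ 4) ∧ 0 ≤ A' ∧
  (∀ y, |f y| ≤ indicator (cube n c d) (fun _ => (d ^ n) ^ (-(1 / p₁))) y) ∧
  (∀ y, |b y * f y| ≤ indicator (cube n c d) (fun _ => A') y) ∧
  ∀ x ∈ E, c0 n α ε * (d ^ n) ^ (-(1 / q)) ≤
    |commI n α b f (indicator (cube n c d) (fun _ => (d ^ n) ^ (-(1 / p₂)))) x|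

lemma cubeData_half (n : ℕ) (hn : 0 < n) (p₁ p₂ q α : ℝ) (hα : 0 < α) (hα2 : α < 2 * n)
    (hq : 1 / q = 1 / p₁ + 1 / p₂ - α / n)
    (b : Rn n → ℝ) (hb : LocallyIntegrable b volume) (c : Rn n) (d : ℝ)
    (hd : 0 < d) (ε : ℝ) (hε : 0 < ε) (ho : ε ≤ osc n b c d) (ho1 : osc n b c d ≤ 1)
    (hhalf : ENNReal.ofReal (d ^ n / 2) ≤ volume (cube n c d ∩ {x | b x ≤ cubeAvg n b c d})) :
    ∃ f A' E, CubeData n p₁ p₂ q α ε b c d f A' E := by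
  obtain ⟨N, hN⟩ := exists_trunc n b hb c d hd ε hε ho
  have hch := cheb n b hb c d hd ho1
  set m := cubeAvg n b c d with hm
  have hbm : AEMeasurable b volume := hb.aestronglyMeasurable.aemeasurable
  have hA : 0 ≤ (d ^ n) ^ (-(1 / p₁)) := by positivity
  have hB : 0 ≤ (d ^ n) ^ (-(1 / p₂)) := by positivity
  set A := (d ^ n) ^ (-(1 / p₁)) with hAdef
  set f : Rn n → ℝ := indicator (cube n c d) (fun y => A * psi N (b y - m)) with hf
  have hfm : AEStronglyMeasurable f volume := by
    refine AEStronglyMeasurable.indicator ?_ (measurableSet_cube n c d)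
    exact (((measurable_psi N).comp_aemeasurable (hbm.sub_const m)).const_mul A).aestronglyMeasurable
  have hf0 : ∀ y, 0 ≤ f y := fun y =>
    indicator_nonneg (fun z _ => mul_nonneg hA (psi_nonneg N _)) y
  have hfA : ∀ y, |f y| ≤ indicator (cube n c d) (fun _ => A) y := by
    intro y
    rw [abs_of_nonneg (hf0 y)]
    refine indicator_le_indicator ?_
    nlinarith [psi_le_one N (b y - m)]
  have hbf : ∀ y, |b y * f y| ≤ indicator (cube n c d) (fun _ => A * (N + |m|)) y := by
    intro y
    by_cases hy : y ∈ cube n c d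
    · rw [hf, indicator_of_mem hy, indicator_of_mem hy]
      have e : b y * (A * psi N (b y - m)) =
        A * ((b y - m) * psi N (b y - m) + m * psi N (b y - m)) := by ring
      rw [e, abs_mul, abs_of_nonneg hA]
      refine mul_le_mul_of_nonneg_left ?_ hA
      refine (abs_add_le _ _).trans (add_le_add (psi_mul_le N _) ?_)
      rw [abs_mul, abs_of_nonneg (psi_nonneg N _)]
      nlinarith [psi_le_one N (b y - m), abs_nonneg m]
    · simp [hf, hy]
  have hfb : ∀ y, 0 ≤ (b y - m) * f y := by
    intro y
    by_cases hy : y ∈ cube n c d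
    · rw [hf, indicator_of_mem hy]
      have := mul_nonneg hA (psi_mul_nonneg N (b y - m))
      linarith
    · simp [hf, hy]
  have hint : A * (d ^ n * (ε / 4)) ≤ ∫ y, (b y - m) * f y := by
    have : ∫ y, (b y - m) * f y =
        A * ∫ x in cube n c d, (b x - m) * psi N (b x - m) := by
      rw [← integral_const_mul, ← integral_indicator (measurableSet_cube n c d)]
      congr 1; ext y
      by_cases hy : y ∈ cube n c d
      · simp only [hf, indicator_of_mem hy]; ring
      · simp [hf, hy]
    rw [this]
    exact mul_le_mul_of_nonneg_left hN hA
  have hnE1 : NullMeasurableSet (cube n c d ∩ {x | b x ≤ m}) volume :=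
    (measurableSet_cube n c d).nullMeasurableSet.inter (nullMeasurableSet_le hbm aemeasurable_const)
  have hnE2 : NullMeasurableSet (cube n c d ∩ {x | 4 ≤ |b x - m|}) volume :=
    (measurableSet_cube n c d).nullMeasurableSet.inter
      (nullMeasurableSet_le aemeasurable_const (hbm.sub_const m).abs)
  refine ⟨f, A * (N + |m|), (cube n c d ∩ {x | b x ≤ m}) \ (cube n c d ∩ {x | 4 ≤ |b x - m|}),
    hnE1.diff hnE2, fun x hx => hx.1.1, ?_, ?_, by positivity, hfA, hbf, ?_⟩
  · refine le_trans ?_ le_measure_diff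
    refine le_trans ?_ (tsub_le_tsub hhalf hch)
    rw [← ENNReal.ofReal_sub _ (by positivity)]
    exact ENNReal.ofReal_le_ofReal (by linarith)
  · intro x hx
    by_contra h
    exact hx.2 ⟨hx.1.1, (not_le.1 h).le⟩
  · intro x hx
    refine le_trans ?_ (le_abs_self _)
    refine le_trans ?_ (comm_lower n hn α hα (by linarith) c d hd.le b f A (A * (N + |m|)) _ m hfm
      hb.aestronglyMeasurable hfA hbf hA (by positivity) hB hf0 hfb x hx.1.1 hx.1.2)
    unfold c0
    rw [← d_arith n hn p₁ p₂ q α hq d hd ε]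
    refine mul_le_mul_of_nonneg_left hint (by positivity)

lemma cubeAvg_neg (n : ℕ) (b : Rn n → ℝ) (c : Rn n) (d : ℝ) :
    cubeAvg n (fun x => - b x) c d = - cubeAvg n b c d := by
  unfold cubeAvg
  rw [setAverage_eq, setAverage_eq, integral_neg, smul_neg]

lemma osc_neg (n : ℕ) (b : Rn n → ℝ) (c : Rn n) (d : ℝ) :
    osc n (fun x => - b x) c d = osc n b c d := by
  unfold osc
  rw [cubeAvg_neg]
  congr 1; ext x
  rw [← abs_neg]; congr 1; ring

lemma commI_neg (n : ℕ) (α : ℝ) (b f g : Rn n → ℝ) (x : Rn n) :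
    commI n α (fun x => - b x) f g x = - commI n α b f g x := by
  have : Iop n α (fun y => - b y * f y) g x = - Iop n α (fun y => b y * f y) g x := by
    unfold Iop
    rw [← integral_neg]
    congr 1; ext y
    rw [← integral_neg]
    congr 1; ext z
    ring
  simp only [commI, this]
  ring

lemma exists_cubeData (n : ℕ) (hn : 0 < n) (p₁ p₂ q α : ℝ) (hα : 0 < α) (hα2 : α < 2 * n)
    (hq : 1 / q = 1 / p₁ + 1 / p₂ - α / n)
    (b : Rn n → ℝ) (hb : LocallyIntegrable b volume) (c : Rn n) (d : ℝ)
    (hd : 0 < d) (ε : ℝ) (hε : 0 < ε) (ho : ε ≤ osc n b c d) (ho1 : osc n b c d ≤ 1) :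
    ∃ f A' E, CubeData n p₁ p₂ q α ε b c d f A' E := by
  by_cases h : ENNReal.ofReal (d ^ n / 2) ≤ volume (cube n c d ∩ {x | b x ≤ cubeAvg n b c d})
  · exact cubeData_half n hn p₁ p₂ q α hα hα2 hq b hb c d hd ε hε ho ho1 h
  · have h' : ENNReal.ofReal (d ^ n / 2) ≤
        volume (cube n c d ∩ {x | - b x ≤ cubeAvg n (fun x => - b x) c d}) := by
      by_contra h2
      rw [cubeAvg_neg] at h2
      have hsub : cube n c d ⊆ (cube n c d ∩ {x | b x ≤ cubeAvg n b c d}) ∪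
          (cube n c d ∩ {x | - b x ≤ - cubeAvg n b c d}) := by
        intro x hx
        rcases le_total (b x) (cubeAvg n b c d) with h3 | h3
        · exact Or.inl ⟨hx, h3⟩
        · exact Or.inr ⟨hx, neg_le_neg h3⟩
      have h3 := (measure_mono hsub).trans (measure_union_le (μ := volume) _ _)
      have h4 := h3.trans_lt (ENNReal.add_lt_add (not_le.1 h) (not_le.1 h2))
      rw [volume_cube n c d hd.le, ← ENNReal.ofReal_add (by positivity) (by positivity)] at h4
      exact absurd h4 (not_lt.2 (ENNReal.ofReal_le_ofReal (by linarith)))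
    obtain ⟨f, A', E, h1, h2, h3, h4, h5, h6, h7, h8⟩ :=
      cubeData_half n hn p₁ p₂ q α hα hα2 hq (fun x => - b x) hb.neg c d hd ε hε
        (by rwa [osc_neg]) (by rwa [osc_neg]) h'
    refine ⟨f, A', E, h1, h2, h3, fun x hx => ?_, h5, h6, fun y => ?_, fun x hx => ?_⟩
    · have := h4 x hx
      rw [cubeAvg_neg, ← abs_neg] at this
      convert this using 2; ring
    · have := h7 y
      rwa [neg_mul, abs_neg] at this
    · have := h8 x hx
      rwa [commI_neg, abs_neg] at this

lemma avg_diff (n : ℕ) (b : Rn n → ℝ) (hb : LocallyIntegrable b volume)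
    (ho : ∀ c d, 0 < d → osc n b c d ≤ 1) (c c' : Rn n) (d d' : ℝ) (hd : 0 < d) (hd' : 0 < d')
    (hsub : cube n c' d' ⊆ cube n c d) :
    |cubeAvg n b c' d' - cubeAvg n b c d| ≤ (d / d') ^ n := by
  set M := cubeAvg n b c d with hM
  have hi : IntegrableOn b (cube n c d) volume := integrableOn_cube n b hb c d hd.le
  have hi' : IntegrableOn b (cube n c' d') volume := integrableOn_cube n b hb c' d' hd'.le
  have hfin : volume (cube n c d) ≠ ∞ := by
    rw [volume_cube n c d hd.le]; exact ENNReal.ofReal_ne_top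
  have hfin' : volume (cube n c' d') ≠ ∞ := by
    rw [volume_cube n c' d' hd'.le]; exact ENNReal.ofReal_ne_top
  have hi1 : IntegrableOn (fun x => |b x - M|) (cube n c d) volume :=
    (hi.sub (integrableOn_const hfin)).abs
  have e1 : ∫ x in cube n c' d', (b x - M) = d' ^ n * (cubeAvg n b c' d' - M) := by
    rw [integral_sub hi' (integrableOn_const hfin'), int_cube n b c' d' hd']
    simp [volReal_cube n c' d' hd'.le]
    ring
  have e2 : |∫ x in cube n c' d', (b x - M)| ≤ d ^ n := by
    calc _ ≤ ∫ x in cube n c' d', |b x - M| := abs_integral_le_integral_abs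
      _ ≤ ∫ x in cube n c d, |b x - M| :=
        setIntegral_mono_set hi1 (Eventually.of_forall fun x => abs_nonneg _)
          hsub.eventuallyLE
      _ = d ^ n * osc n b c d := int_osc n b c d hd
      _ ≤ d ^ n * 1 := by gcongr; exact ho c d hd
      _ = _ := mul_one _
  rw [e1, abs_mul, abs_of_pos (by positivity : 0 < d' ^ n)] at e2
  rw [div_pow, le_div_iff₀ (by positivity)]
  linarith

lemma avg_chain (n : ℕ) (b : Rn n → ℝ) (hb : LocallyIntegrable b volume)
    (ho : ∀ c d, 0 < d → osc n b c d ≤ 1) (c : Rn n) (d : ℝ) (hd : 0 < d) (N : ℕ) :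
    |cubeAvg n b c d - cubeAvg n b c (2 ^ N * d)| ≤ N * 2 ^ n := by
  induction N with
  | zero => simp
  | succ N ih =>
    have h := avg_diff n b hb ho c c (2 ^ (N + 1) * d) (2 ^ N * d) (by positivity) (by positivity)
      (fun x hx i => (hx i).trans (by
        have : 0 < (2:ℝ) ^ N * d := by positivity
        rw [pow_succ]; linarith))
    have e : 2 ^ (N + 1) * d / (2 ^ N * d) = 2 := by
      rw [pow_succ]; field_simp
    rw [e] at h
    have := abs_sub_le (cubeAvg n b c d) (cubeAvg n b c (2 ^ N * d)) (cubeAvg n b c (2 ^ (N + 1) * d))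
    push_cast
    linarith

lemma nat_le_rpow (N : ℕ) (Y s : ℝ) (hs : 0 < s) (h : (2:ℝ) ^ N ≤ Y) :
    (N:ℝ) ≤ (s * Real.log 2)⁻¹ * Y ^ s := by
  have hY : 0 < Y := lt_of_lt_of_le (by positivity) h
  have h2 : 0 < Real.log 2 := Real.log_pos (by norm_num)
  have h1 : N * Real.log 2 ≤ Y ^ s / s := by
    calc N * Real.log 2 = Real.log (2 ^ N) := (Real.log_pow 2 N).symm
      _ ≤ Real.log Y := Real.log_le_log (by positivity) h
      _ ≤ _ := Real.log_le_rpow_div hY.le hs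
  rw [inv_mul_eq_div, le_div_iff₀ (by positivity)]
  rw [le_div_iff₀ hs] at h1
  linarith

lemma avg_growth (n : ℕ) (b : Rn n → ℝ) (hb : LocallyIntegrable b volume)
    (ho : ∀ c d, 0 < d → osc n b c d ≤ 1) (s : ℝ) (hs : 0 < s) :
    ∃ C : ℝ, 0 ≤ C ∧ ∀ (c : Rn n) (d : ℝ), 0 < d → d ≤ 1 →
      |cubeAvg n b c d| ≤ C * ((1 + ‖c‖) / d) ^ s := by
  set κ := (s * Real.log 2)⁻¹ with hκ
  have h2 : 0 < Real.log 2 := Real.log_pos (by norm_num)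
  have hκ0 : 0 ≤ κ := by positivity
  refine ⟨(2 * κ * 2 ^ n + 8 ^ n + |cubeAvg n b 0 1|) * 16 ^ s, by positivity, ?_⟩
  intro c d hd hd1
  set L := 1 + ‖c‖ with hL
  have hL1 : 1 ≤ L := by have := norm_nonneg c; linarith
  obtain ⟨N, hN1, hN2⟩ := exists_nat_pow_near (x := 4 * L / d) (y := (2:ℝ))
    (by rw [le_div_iff₀ hd]; linarith) (by norm_num)
  obtain ⟨M, hM1, hM2⟩ := exists_nat_pow_near (x := 16 * L) (y := (2:ℝ))
    (by linarith) (by norm_num)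
  rw [pow_succ] at hN2 hM2
  rw [div_lt_iff₀ hd] at hN2
  have hN1' := hN1
  rw [le_div_iff₀ hd] at hN1
  set Y := 16 * L / d with hY
  have hYL : 16 * L ≤ Y := by
    rw [hY, le_div_iff₀ hd]; nlinarith
  have hN := nat_le_rpow N Y s hs (hN1'.trans (by rw [hY]; gcongr; norm_num))
  have hM := nat_le_rpow M Y s hs (hM1.trans hYL)
  have hY1 : 1 ≤ Y ^ s := Real.one_le_rpow (by linarith) hs.le
  have a1 := avg_chain n b hb ho c d hd N
  have a2 := avg_chain n b hb ho 0 1 one_pos M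
  rw [mul_one] at a2
  have a3 := avg_diff n b hb ho 0 c (2 ^ M) (2 ^ N * d) (by positivity) (by positivity) (by
    intro x hx i
    have h1 := hx i
    have h3 : |c i| ≤ ‖c‖ := PiLp.norm_apply_le c i
    simp only [PiLp.zero_apply, sub_zero]
    have : |x i| ≤ |x i - c i| + |c i| := by
      calc |x i| = |(x i - c i) + c i| := by congr 1; ring
        _ ≤ _ := abs_add_le _ _
    linarith)
  have a4 : (2 ^ M / (2 ^ N * d) : ℝ) ^ n ≤ 8 ^ n := by
    refine pow_le_pow_left₀ (by positivity) ?_ n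
    rw [div_le_iff₀ (by positivity)]
    linarith
  have a5 : |cubeAvg n b c d| ≤ N * 2 ^ n + 8 ^ n + M * 2 ^ n + |cubeAvg n b 0 1| := by
    have t1 := abs_le.1 a1
    have t2 := abs_le.1 a2
    have t3 := abs_le.1 (a3.trans a4)
    have t4 := neg_abs_le (cubeAvg n b 0 1)
    have t5 := le_abs_self (cubeAvg n b 0 1)
    exact abs_le.2 ⟨by linarith, by linarith⟩
  have hYs : Y ^ s = 16 ^ s * (L / d) ^ s := by
    rw [hY, mul_div_assoc, Real.mul_rpow (by norm_num) (by positivity)]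
  rw [mul_assoc, ← hYs]
  have p2 : (0:ℝ) < 2 ^ n := by positivity
  have p8 : (0:ℝ) < 8 ^ n := by positivity
  have pa := abs_nonneg (cubeAvg n b 0 1)
  have q1 := mul_le_mul_of_nonneg_right hN p2.le
  have q2 := mul_le_mul_of_nonneg_right hM p2.le
  have q3 := mul_le_mul_of_nonneg_left hY1 p8.le
  have q4 := mul_le_mul_of_nonneg_left hY1 pa
  calc _ ≤ _ := a5
    _ ≤ κ * Y ^ s * 2 ^ n + 8 ^ n * Y ^ s + κ * Y ^ s * 2 ^ n + |cubeAvg n b 0 1| * Y ^ s := by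
      linarith
    _ = _ := by ring

lemma osc_le_one (n : ℕ) (b : Rn n → ℝ) (hbmo : bmoNorm n b = 1) (c : Rn n) (d : ℝ) (hd : 0 < d) :
    osc n b c d ≤ 1 := by
  have hbdd : BddAbove (range fun cd : Rn n × {d : ℝ // 0 < d} => osc n b cd.1 cd.2.1) := by
    by_contra h
    rw [bmoNorm, Real.iSup_of_not_bddAbove h] at hbmo
    norm_num at hbmo
  rw [← hbmo]
  exact le_ciSup hbdd (⟨c, ⟨d, hd⟩⟩ : Rn n × {d : ℝ // 0 < d})

/-- Decay of an earlier image on later small cubes. -/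
lemma small_on_later (n : ℕ) (hn : 0 < n) (q α : ℝ) (hα₂ : α < 2 * n) (hq' : 1 < q)
    (b : Rn n → ℝ) (hb : LocallyIntegrable b volume)
    (ho : ∀ c d, 0 < d → osc n b c d ≤ 1)
    (cc : ℕ → Rn n) (d : ℕ → ℝ) (hd : ∀ j, 0 < d j)
    (hsize : Tendsto (fun j => d j ^ n) atTop (𝓝 0)) (E : ℕ → Set (Rn n))
    (hE : ∀ k, E k ⊆ cube n (cc k) (d k))
    (hEb : ∀ k, ∀ x ∈ E k, |b x - cubeAvg n b (cc k) (d k)| ≤ 4)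
    (u : Rn n → ℝ) (C : ℝ) (hC : 0 ≤ C)
    (hu : ∀ x, |u x| ≤ C * (1 + |b x|) * (1 + ‖x‖) ^ (-(2 * n - α)))
    (δ : ℝ) (hδ : 0 < δ) :
    ∀ᶠ k in atTop, ∀ x ∈ E k, |u x| ≤ δ * (d k ^ n) ^ (-(1 / q)) := by
  have hn' : (0:ℝ) < n := by positivity
  set β : ℝ := 2 * n - α with hβ
  have hβ0 : 0 < β := by linarith
  set s : ℝ := min β (n / (2 * q)) with hs
  have hs0 : 0 < s := lt_min hβ0 (by positivity)
  have hsβ : s ≤ β := min_le_left _ _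
  obtain ⟨C1, hC1, hav⟩ := avg_growth n b hb ho s hs0
  set θ : ℝ := 1 / q - s / n with hθ
  have hθ0 : 0 < θ := by
    have h1 : s / n ≤ 1 / (2 * q) := by
      rw [div_le_iff₀ hn']
      refine (min_le_right _ _).trans (le_of_eq (by field_simp))
    have h2 : 1 / (2 * q) < 1 / q := by
      apply one_div_lt_one_div_of_lt <;> linarith
    linarith
  set C2 := C * (5 + C1) * (n + 2) ^ s with hC2
  have ht : Tendsto (fun k => C2 * (d k ^ n) ^ θ) atTop (𝓝 0) := by
    have := (hsize.rpow_const (Or.inr hθ0.le)).const_mul C2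
    rwa [Real.zero_rpow hθ0.ne', mul_zero] at this
  filter_upwards [ht.eventually (gt_mem_nhds hδ), hsize.eventually (gt_mem_nhds one_pos)]
    with k hk1 hk2 x hx
  have hdk := hd k
  have hdk1 : d k ≤ 1 := by
    by_contra h
    push Not at h
    exact absurd hk2 (not_lt.2 (one_le_pow₀ h.le))
  have hxQ := hE k hx
  set L := 1 + ‖cc k‖ with hL
  have hL1 : 1 ≤ L := by have := norm_nonneg (cc k); linarith
  have hLd : 1 ≤ L / d k := by rw [le_div_iff₀ hdk]; linarith
  have hLds : 1 ≤ (L / d k) ^ s := Real.one_le_rpow hLd hs0.le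
  have hbx : 1 + |b x| ≤ (5 + C1) * (L / d k) ^ s := by
    have h1 := hav (cc k) (d k) hdk hdk1
    have h2 := hEb k x hx
    have h3 : |b x| ≤ |b x - cubeAvg n b (cc k) (d k)| + |cubeAvg n b (cc k) (d k)| := by
      calc |b x| = |(b x - cubeAvg n b (cc k) (d k)) + cubeAvg n b (cc k) (d k)| := by
            congr 1; ring
        _ ≤ _ := abs_add_le _ _
    nlinarith
  have hLx : L ≤ (n + 2) * (1 + ‖x‖) := by
    have hc : cc k ∈ cube n (cc k) (d k) := fun i => by simp; linarith
    have h := cube_dist_sq n (cc k) (d k) hdk.le (cc k) x hc hxQ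
    have h2 : ‖cc k - x‖ ≤ (n + 1) * d k := by
      refine abs_le_of_sq_le_sq' ?_ (by positivity) |>.2
      have e1 : 0 ≤ (n:ℝ) * d k ^ 2 := by positivity
      have e2 : 0 ≤ (n:ℝ) * n * d k ^ 2 := by positivity
      nlinarith [sq_nonneg (d k)]
    have h3 : ‖cc k‖ ≤ ‖cc k - x‖ + ‖x‖ := by
      calc ‖cc k‖ = ‖(cc k - x) + x‖ := by congr 1; abel
        _ ≤ _ := norm_add_le _ _
    have h4 : (n + 1) * d k ≤ (n + 1 : ℝ) := by nlinarith
    nlinarith [norm_nonneg x]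
  have hxp : 1 ≤ 1 + ‖x‖ := by have := norm_nonneg x; linarith
  have hmain : L ^ s * (1 + ‖x‖) ^ (-β) ≤ (n + 2) ^ s := by
    calc L ^ s * (1 + ‖x‖) ^ (-β) ≤ ((n + 2) * (1 + ‖x‖)) ^ s * (1 + ‖x‖) ^ (-β) := by
          gcongr
      _ = (n + 2) ^ s * (1 + ‖x‖) ^ (s + -β) := by
          rw [Real.mul_rpow (by positivity) (by positivity), Real.rpow_add (by positivity)]; ring
      _ ≤ (n + 2) ^ s * 1 := by
          gcongr
          exact Real.rpow_le_one_of_one_le_of_nonpos hxp (by linarith)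
      _ = _ := mul_one _
  have hds : ((d k) ^ s)⁻¹ = (d k ^ n) ^ θ * (d k ^ n) ^ (-(1 / q)) := by
    rw [← Real.rpow_add (by positivity), ← Real.rpow_natCast, ← Real.rpow_mul hdk.le,
      ← Real.rpow_neg hdk.le]
    congr 1
    rw [hθ]; field_simp; ring
  calc |u x| ≤ C * (1 + |b x|) * (1 + ‖x‖) ^ (-β) := hu x
    _ ≤ C * ((5 + C1) * (L / d k) ^ s) * (1 + ‖x‖) ^ (-β) := by gcongr
    _ = C * (5 + C1) * (L ^ s * (1 + ‖x‖) ^ (-β)) * ((d k) ^ s)⁻¹ := by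
        rw [Real.div_rpow (by positivity) hdk.le]; ring
    _ ≤ C * (5 + C1) * (n + 2) ^ s * ((d k) ^ s)⁻¹ := by gcongr
    _ = (C2 * (d k ^ n) ^ θ) * (d k ^ n) ^ (-(1 / q)) := by rw [hds, hC2]; ring
    _ ≤ δ * (d k ^ n) ^ (-(1 / q)) := by gcongr

/-- Lower bound of the norm from a pointwise lower bound on a set. -/
lemma wNorm_ge (n : ℕ) (q : ℝ) (hq : 0 < q) (E : Set (Rn n)) (hE : NullMeasurableSet E volume)
    (V δ : ℝ) (hV : 0 < V) (hδ : 0 < δ) (hvol : ENNReal.ofReal (V / 4) ≤ volume E)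
    (u : Rn n → ℝ) (hu : ∀ x ∈ E, δ * V ^ (-(1 / q)) ≤ |u x|) :
    ENNReal.ofReal (δ * (1 / 4) ^ (1 / q)) ≤ wNorm n q (fun _ => 1) u := by
  unfold wNorm
  have e : δ * (1 / 4 : ℝ) ^ (1 / q) = (δ ^ q * (1 / 4)) ^ (1 / q) := by
    rw [Real.mul_rpow (by positivity) (by norm_num), ← Real.rpow_mul hδ.le,
      mul_one_div_cancel hq.ne', Real.rpow_one]
  rw [e, ← ENNReal.ofReal_rpow_of_nonneg (by positivity) (by positivity)]
  refine ENNReal.rpow_le_rpow ?_ (by positivity)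
  have hVq : (V ^ (-(1 / q))) ^ q = V⁻¹ := by
    rw [← Real.rpow_mul hV.le, ← Real.rpow_neg_one]
    congr 1; field_simp
  calc ENNReal.ofReal (δ ^ q * (1 / 4))
      = ENNReal.ofReal (δ ^ q * V⁻¹) * ENNReal.ofReal (V / 4) := by
        rw [← ENNReal.ofReal_mul (by positivity)]
        congr 1; field_simp
    _ ≤ ENNReal.ofReal (δ ^ q * V⁻¹) * volume E := by gcongr
    _ = ∫⁻ x, indicator E (fun _ => ENNReal.ofReal (δ ^ q * V⁻¹)) x := by
        rw [lintegral_indicator_const₀ hE]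
    _ ≤ _ := by
        refine lintegral_mono fun x => ?_
        by_cases hx : x ∈ E
        · rw [indicator_of_mem hx]
          refine ENNReal.ofReal_le_ofReal ?_
          rw [mul_one, ← hVq, ← Real.mul_rpow hδ.le (by positivity)]
          exact Real.rpow_le_rpow (by positivity) (hu x hx) hq.le
        · rw [indicator_of_notMem hx]; simp

/-- If `b` is a real-valued BMO function with `‖b‖_{BMO} = 1` whose mean
oscillations stay above `ε` on a sequence of cubes with `|Q_j| → 0`, then there are bounded
sequences in `L^{p₁}` and `L^{p₂}` whose images under `[b,I_α]₁` are uniformly separated in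
`L^q`; in particular `[b,I_α]₁` is not compact from `L^{p₁} × L^{p₂}` to `L^q`. -/
theorem statement17 (n : ℕ) (hn : 0 < n) (p₁ p₂ q α : ℝ)
    (hp₁ : 1 < p₁) (hp₂ : 1 < p₂)
    (hα₀ : 0 < α) (hα₂ : α < 2 * n)
    (hαp : α / n < 1 / p₁ + 1 / p₂) (hsum : 1 / p₁ + 1 / p₂ < 2)
    (hq : 1 / q = 1 / p₁ + 1 / p₂ - α / n) (hq' : 1 < q)
    (b : Rn n → ℝ) (hb : LocallyIntegrable b volume) (hbmo : bmoNorm n b = 1)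
    (ε : ℝ) (hε : 0 < ε)
    (cc : ℕ → Rn n) (d : ℕ → ℝ) (hd : ∀ j, 0 < d j)
    (hsize : Tendsto (fun j => d j ^ n) atTop (𝓝 0))
    (hosc : ∀ j, ε ≤ osc n b (cc j) (d j)) :
    ∃ (F G : ℕ → Rn n → ℝ) (c : ℝ), 0 < c ∧
      (∃ M : ℝ, ∀ j, wNorm n p₁ (fun _ => 1) (F j) ≤ ENNReal.ofReal M) ∧
      (∃ M : ℝ, ∀ j, wNorm n p₂ (fun _ => 1) (G j) ≤ ENNReal.ofReal M) ∧
      (∀ j k : ℕ, j ≠ k →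
        ENNReal.ofReal c ≤
          wNorm n q (fun _ => 1)
            (fun x => commI n α b (F j) (G j) x - commI n α b (F k) (G k) x)) ∧
      ¬ BilinCompact n p₁ p₂ q (fun _ => 1) (fun _ => 1) (fun _ => 1) (commI n α b) := by
  have hn' : (0:ℝ) < n := by positivity
  have hq0 : 0 < q := by linarith
  have ho : ∀ c d, 0 < d → osc n b c d ≤ 1 := fun c d hd => osc_le_one n b hbmo c d hd
  have hdata := fun j => exists_cubeData n hn p₁ p₂ q α hα₀ hα₂ hq b hb (cc j) (d j) (hd j) ε hε
    (hosc j) (ho _ _ (hd j))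
  choose f A' E hD using hdata
  set g : ℕ → Rn n → ℝ := fun j =>
    indicator (cube n (cc j) (d j)) (fun _ => (d j ^ n) ^ (-(1 / p₂))) with hg
  have hgb : ∀ j y, |g j y| ≤
      indicator (cube n (cc j) (d j)) (fun _ => (d j ^ n) ^ (-(1 / p₂))) y := fun j y => by
    have hdj := hd j
    rw [abs_of_nonneg (indicator_nonneg (fun _ _ => by positivity) _)]
  have hδ : 0 < c0 n α ε := by unfold c0; positivity
  have hup : ∀ j, ∃ C : ℝ, 0 ≤ C ∧ ∀ x, |commI n α b (f j) (g j) x| ≤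
      C * (1 + |b x|) * (1 + ‖x‖) ^ (-(2 * n - α)) := by
    intro j
    have hdj := hd j
    obtain ⟨-, -, -, -, h5, h6, h7, -⟩ := hD j
    exact comm_upper n hn α hα₀ (by linarith) (cc j) (d j) hdj.le b (f j) (g j) _ _ _ h6 h7
      (hgb j) (by positivity) h5 (by positivity)
  have hsm : ∀ j, ∀ᶠ k in atTop, ∀ x ∈ E k, |commI n α b (f j) (g j) x| ≤
      (c0 n α ε / 2) * (d k ^ n) ^ (-(1 / q)) := by
    intro j
    obtain ⟨C, hC, hu⟩ := hup j
    exact small_on_later n hn q α hα₂ hq' b hb ho cc d hd hsize E (fun k => (hD k).2.1)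
      (fun k => (hD k).2.2.2.1) _ C hC hu _ (by positivity)
  obtain ⟨φ, -, hφ⟩ := exists_seq_of_forall_finset_exists (fun _ : ℕ => True)
    (fun j k => ∀ x ∈ E k, |commI n α b (f j) (g j) x| ≤
      (c0 n α ε / 2) * (d k ^ n) ^ (-(1 / q))) (by
      intro s _
      have : ∀ᶠ k in atTop, ∀ j ∈ s, ∀ x ∈ E k, |commI n α b (f j) (g j) x| ≤
          (c0 n α ε / 2) * (d k ^ n) ^ (-(1 / q)) :=
        (Filter.eventually_all_finset s).2 fun j _ => hsm j
      obtain ⟨k, hk⟩ := this.exists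
      exact ⟨k, trivial, hk⟩)
  set c := (c0 n α ε / 2) * (1 / 4 : ℝ) ^ (1 / q) with hc
  have hc0 : 0 < c := by positivity
  have hlt : ∀ j k : ℕ, j < k → ENNReal.ofReal c ≤ wNorm n q (fun _ => 1)
      (fun x => commI n α b (f (φ j)) (g (φ j)) x - commI n α b (f (φ k)) (g (φ k)) x) := by
    intro j k hjk
    obtain ⟨h1, h2, h3, -, -, -, -, h8⟩ := hD (φ k)
    have hdk := hd (φ k)
    refine wNorm_ge n q hq0 (E (φ k)) h1 (d (φ k) ^ n) _ (by positivity) (by positivity) h3 _ ?_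
    intro x hx
    have a1 := h8 x hx
    have a2 := hφ j k hjk x hx
    have a3 := abs_sub_abs_le_abs_sub (commI n α b (f (φ k)) (g (φ k)) x)
      (commI n α b (f (φ j)) (g (φ j)) x)
    rw [abs_sub_comm] at a3
    change _ ≤ |commI n α b (f (φ k)) (g (φ k)) x| at a1
    linarith
  have hne : ∀ j k : ℕ, j ≠ k → ENNReal.ofReal c ≤ wNorm n q (fun _ => 1)
      (fun x => commI n α b (f (φ j)) (g (φ j)) x - commI n α b (f (φ k)) (g (φ k)) x) := by
    intro j k hjk
    rcases lt_or_gt_of_ne hjk with h | h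
    · exact hlt j k h
    · have := hlt k j h
      unfold wNorm at this ⊢
      simp_rw [abs_sub_comm (commI n α b (f (φ j)) (g (φ j)) _)]
      exact this
  have hF : ∀ j, wNorm n p₁ (fun _ => 1) (f (φ j)) ≤ 1 := fun j =>
    wNorm_le_one n p₁ (by linarith) (cc (φ j)) (d (φ j)) (hd _) _ (hD (φ j)).2.2.2.2.2.1
  have hG : ∀ j, wNorm n p₂ (fun _ => 1) (g (φ j)) ≤ 1 := fun j =>
    wNorm_le_one n p₂ (by linarith) (cc (φ j)) (d (φ j)) (hd _) _ (hgb (φ j))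
  refine ⟨fun j => f (φ j), fun j => g (φ j), c, hc0, ⟨1, fun j => by simpa using hF j⟩,
    ⟨1, fun j => by simpa using hG j⟩, hne, ?_⟩
  intro hcomp
  obtain ⟨ψ, hψ, hcau⟩ := hcomp (fun j => f (φ j)) (fun j => g (φ j)) hF hG
  obtain ⟨N, hN⟩ := hcau c hc0
  have h1 := hN N le_rfl (N + 1) (Nat.le_succ N)
  have h2 := hne (ψ N) (ψ (N + 1)) (hψ (Nat.lt_succ_self N)).ne
  exact absurd h1 (not_lt.2 h2)
end
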